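/- Let ρ be a quantum state on a finite-dimensional complex Hilbert space H, let {S_n}_{n≥1} satisfy Assumption 1, and suppose S_1 contains a state whose support contains supp(ρ). Then the Chernoff exponent satisfies c(ρ‖{S_n}) = lim_{n→∞} (1/n) sup_{α ∈ (0,1)} min_{σ⁽ⁿ⁾ ∈ S_n} (1−α) D_α(ρ^{⊗n}‖σ⁽ⁿ⁾) = lim_{n→∞} (1/n) min_{σ⁽ⁿ⁾ ∈ S_n} sup_{α ∈ (0,1)} (1−α) D_α(ρ^{⊗n}‖σ⁽ⁿ⁾), and in particular both limits exist and are equal. -/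

import Mathlib

open scoped BigOperators ComplexOrder Classical
open MeasureTheory Filter Set

noncomputable section

namespace QHT

variable {ι : Type*} [Fintype ι] [DecidableEq ι]

/-- Generalized matrix power `A ^ w` (complex exponent `w`) of a Hermitian matrix,
via functional calculus on the support: the eigenvalue `0` is mapped to `0`. -/
def mpow (A : Matrix ι ι ℂ) (w : ℂ) : Matrix ι ι ℂ :=
  if hA : A.IsHermitian then
    (hA.eigenvectorUnitary : Matrix ι ι ℂ) *
      Matrix.diagonal (fun i => if hA.eigenvalues i = 0 then 0 else (hA.eigenvalues i : ℂ) ^ w) *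
      star (hA.eigenvectorUnitary : Matrix ι ι ℂ)
  else 0

/-- Matrix logarithm of a Hermitian matrix, taken on its support
(`Real.log 0 = 0`, so the kernel is mapped to `0`). -/
def mlog (A : Matrix ι ι ℂ) : Matrix ι ι ℂ :=
  if hA : A.IsHermitian then
    (hA.eigenvectorUnitary : Matrix ι ι ℂ) *
      Matrix.diagonal (fun i => (Real.log (hA.eigenvalues i) : ℂ)) *
      star (hA.eigenvectorUnitary : Matrix ι ι ℂ)
  else 0

/-- The support of a matrix, i.e. its range as a linear map. -/
def msupp (A : Matrix ι ι ℂ) : Submodule ℂ (ι → ℂ) := LinearMap.range A.mulVecLin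

/-- A quantum state: a positive semidefinite matrix of trace one. -/
def IsState (A : Matrix ι ι ℂ) : Prop := A.PosSemidef ∧ A.trace = 1

/-- Real part of the trace. -/
def rtr (A : Matrix ι ι ℂ) : ℝ := A.trace.re

/-- The Umegaki relative entropy `D(ρ‖σ)`, with value `+∞` when `supp ρ ⊄ supp σ`. -/
def relEnt (ρ σ : Matrix ι ι ℂ) : EReal :=
  if msupp ρ ≤ msupp σ then ((rtr (ρ * (mlog ρ - mlog σ)) : ℝ) : EReal) else ⊤

/-- The polar of a set of matrices (intersected with the PSD cone). -/
def polar (S : Set (Matrix ι ι ℂ)) : Set (Matrix ι ι ℂ) :=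
  {X | X.PosSemidef ∧ ∀ Y ∈ S, rtr (X * Y) ≤ 1}

/-- Entrywise Bochner integral of a matrix-valued function over `ℝ`. -/
def mInt (f : ℝ → Matrix ι ι ℂ) : Matrix ι ι ℂ :=
  Matrix.of fun i j => ∫ t : ℝ, f t i j

/-- Entrywise Bochner integral of a matrix-valued function over a set `s ⊆ ℝ`. -/
def mIntOn (f : ℝ → Matrix ι ι ℂ) (s : Set ℝ) : Matrix ι ι ℂ :=
  Matrix.of fun i j => ∫ t in s, f t i j

/-- `sinc` function. -/
def sinc (s : ℝ) : ℝ := if s = 0 then 1 else Real.sin s / s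

/-- The probability density `β_θ` from the paper (`β₀` is the `θ → 0` limit). -/
def betaDist (θ t : ℝ) : ℝ :=
  if θ = 0 then Real.pi / (2 * (Real.cosh (Real.pi * t) + 1))
  else Real.sin (θ * Real.pi) / (2 * θ * (Real.cosh (Real.pi * t) + Real.cos (θ * Real.pi)))

/-- `Q_{α,z}(ρ‖σ) = Tr[(ρ^{α/2z} σ^{(1-α)/z} ρ^{α/2z})^z]`. -/
def Qaz (α z : ℝ) (ρ σ : Matrix ι ι ℂ) : ℝ :=
  rtr (mpow (mpow ρ ((α / (2 * z) : ℝ) : ℂ) * mpow σ (((1 - α) / z : ℝ) : ℂ) *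
      mpow ρ ((α / (2 * z) : ℝ) : ℂ)) ((z : ℝ) : ℂ))

/-- The `α`-`z` Rényi relative entropy. -/
def Daz (α z : ℝ) (ρ σ : Matrix ι ι ℂ) : EReal :=
  if (α < 1 ∧ (ρ * σ).trace ≠ 0) ∨ msupp ρ ≤ msupp σ then
    (((α - 1)⁻¹ * Real.log (Qaz α z ρ σ) : ℝ) : EReal)
  else ⊤

/-- `Q_α(ρ‖σ) = Tr[ρ^α σ^{1-α}]` (Petz). -/
def Qpetz (α : ℝ) (ρ σ : Matrix ι ι ℂ) : ℝ :=
  rtr (mpow ρ ((α : ℝ) : ℂ) * mpow σ (((1 - α) : ℝ) : ℂ))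

/-- The Petz Rényi divergence. -/
def Dpetz (α : ℝ) (ρ σ : Matrix ι ι ℂ) : EReal :=
  if (α < 1 ∧ (ρ * σ).trace ≠ 0) ∨ msupp ρ ≤ msupp σ then
    (((α - 1)⁻¹ * Real.log (Qpetz α ρ σ) : ℝ) : EReal)
  else ⊤

/-- `Q̃_α(ρ‖σ) = Tr[(σ^{(1-α)/2α} ρ σ^{(1-α)/2α})^α]` (sandwiched). -/
def Qsand (α : ℝ) (ρ σ : Matrix ι ι ℂ) : ℝ :=
  rtr (mpow (mpow σ (((1 - α) / (2 * α) : ℝ) : ℂ) * ρ * mpow σ (((1 - α) / (2 * α) : ℝ) : ℂ))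
    ((α : ℝ) : ℂ))

/-- The sandwiched Rényi divergence. -/
def Dsand (α : ℝ) (ρ σ : Matrix ι ι ℂ) : EReal :=
  if (α < 1 ∧ (ρ * σ).trace ≠ 0) ∨ msupp ρ ≤ msupp σ then
    (((α - 1)⁻¹ * Real.log (Qsand α ρ σ) : ℝ) : EReal)
  else ⊤

/-- `D̃_∞(ρ‖σ)`: the limit of `D̃_α(ρ‖σ)` as `α → +∞` (encoded as a `limsup`; the limit
exists by monotonicity in `α`). -/
def DsandInf (ρ σ : Matrix ι ι ℂ) : EReal :=
  Filter.limsup (fun α : ℝ => Dsand α ρ σ) Filter.atTop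

/-- `χ_{α,z}(ρ,σ) = ρ^{α/2z} (ρ^{α/2z} σ^{(1-α)/z} ρ^{α/2z})^{z-1} ρ^{α/2z}`. -/
def chi (α z : ℝ) (ρ σ : Matrix ι ι ℂ) : Matrix ι ι ℂ :=
  mpow ρ ((α / (2 * z) : ℝ) : ℂ) *
    mpow (mpow ρ ((α / (2 * z) : ℝ) : ℂ) * mpow σ (((1 - α) / z : ℝ) : ℂ) *
      mpow ρ ((α / (2 * z) : ℝ) : ℂ)) (((z - 1 : ℝ)) : ℂ) *
    mpow ρ ((α / (2 * z) : ℝ) : ℂ)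

/-- The data-processing region `𝒟` for `α`-`z` Rényi relative entropies. -/
def Dregion : Set (ℝ × ℝ) :=
  {p | (0 < p.1 ∧ p.1 < 1 ∧ max p.1 (1 - p.1) ≤ p.2) ∨
       (1 < p.1 ∧ max (p.1 / 2) (p.1 - 1) ≤ p.2 ∧ p.2 ≤ p.1) ∨
       (p.1 = 1 ∧ 0 < p.2)}

end QHT

namespace QHT

variable {ι : Type*} [Fintype ι] [DecidableEq ι]

/-! ### Tensor products and many copies -/

/-- Tensor product of a `d₁`- and a `d₂`-dimensional operator, as a `d₁d₂`-dimensional one. -/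
def dtens {a b : ℕ} (A : Matrix (Fin a) (Fin a) ℂ) (B : Matrix (Fin b) (Fin b) ℂ) :
    Matrix (Fin (a * b)) (Fin (a * b)) ℂ :=
  Matrix.of fun x y =>
    A (finProdFinEquiv.symm x).1 (finProdFinEquiv.symm y).1 *
      B (finProdFinEquiv.symm x).2 (finProdFinEquiv.symm y).2

/-- `ρ^{⊗n}` of a `d`-dimensional operator, as a `d^n`-dimensional operator. -/
def dpow {d : ℕ} (ρ : Matrix (Fin d) (Fin d) ℂ) (n : ℕ) :
    Matrix (Fin (d ^ n)) (Fin (d ^ n)) ℂ :=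
  Matrix.of fun x y => ∏ i, ρ (finFunctionFinEquiv.symm x i) (finFunctionFinEquiv.symm y i)

/-- The action of a permutation of the `k` tensor factors on an operator on `(ℂ^d)^{⊗k}`. -/
def permMat (d k : ℕ) (π : Equiv.Perm (Fin k)) (A : Matrix (Fin (d ^ k)) (Fin (d ^ k)) ℂ) :
    Matrix (Fin (d ^ k)) (Fin (d ^ k)) ℂ :=
  Matrix.of fun x y =>
    A (finFunctionFinEquiv ((finFunctionFinEquiv.symm x) ∘ π))
      (finFunctionFinEquiv ((finFunctionFinEquiv.symm y) ∘ π))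

/-- `ρ^{⊗n}` of a `d`-dimensional operator, as an operator on `H^{⊗n}` with `H = ℂ^d`,
indexed by tuples. -/
def tpow {d : ℕ} (ρ : Matrix (Fin d) (Fin d) ℂ) (n : ℕ) :
    Matrix (Fin n → Fin d) (Fin n → Fin d) ℂ :=
  Matrix.of fun x y => ∏ i, ρ (x i) (y i)

/-- Tensor product of an operator on `H^{⊗m}` and an operator on `H^{⊗n}`, as an
operator on `H^{⊗(m+n)}`. -/
def tensOp {d m n : ℕ} (A : Matrix (Fin m → Fin d) (Fin m → Fin d) ℂ)
    (B : Matrix (Fin n → Fin d) (Fin n → Fin d) ℂ) :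
    Matrix (Fin (m + n) → Fin d) (Fin (m + n) → Fin d) ℂ :=
  Matrix.of fun x y =>
    A (fun i => x (Fin.castAdd n i)) (fun i => y (Fin.castAdd n i)) *
      B (fun j => x (Fin.natAdd m j)) (fun j => y (Fin.natAdd m j))

/-- Permutation action on operators on `H^{⊗k}`. -/
def permOp {d k : ℕ} (π : Equiv.Perm (Fin k))
    (A : Matrix (Fin k → Fin d) (Fin k → Fin d) ℂ) :
    Matrix (Fin k → Fin d) (Fin k → Fin d) ℂ :=
  Matrix.of fun x y => A (x ∘ π) (y ∘ π)

/-! ### Hypothesis testing -/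

/-- A test: an operator `T` with `0 ≤ T ≤ I`. -/
def IsTest (T : Matrix ι ι ℂ) : Prop := T.PosSemidef ∧ (1 - T).PosSemidef

/-- Type I error `α_n(ρ|T) = Tr[(I - T) ρ^{⊗n}]`. -/
def typeI {d : ℕ} (ρ : Matrix (Fin d) (Fin d) ℂ) (n : ℕ)
    (T : Matrix (Fin n → Fin d) (Fin n → Fin d) ℂ) : ℝ :=
  rtr ((1 - T) * tpow ρ n)

/-- Type II error `β_n(S|T) = sup_{σ ∈ S} Tr[σ T]`. -/
def typeII {d n : ℕ} (S : Set (Matrix (Fin n → Fin d) (Fin n → Fin d) ℂ))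
    (T : Matrix (Fin n → Fin d) (Fin n → Fin d) ℂ) : ℝ :=
  sSup ((fun σ => rtr (σ * T)) '' S)

/-- `- log x`, valued in `EReal`, with `- log x = +∞` for `x ≤ 0`. -/
def negLog (x : ℝ) : EReal := if x ≤ 0 then ⊤ else ((- Real.log x : ℝ) : EReal)

/-- The exponential rate `-(1/n) log x`. -/
def rate (n : ℕ) (x : ℝ) : EReal := (((n : ℝ)⁻¹ : ℝ) : EReal) * negLog x

/-- The Stein exponent `s(ρ‖{S_n})`. -/
def steinExp {d : ℕ} (ρ : Matrix (Fin d) (Fin d) ℂ)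
    (S : (n : ℕ) → Set (Matrix (Fin n → Fin d) (Fin n → Fin d) ℂ)) : EReal :=
  sSup ((fun r : ℝ => (r : EReal)) ''
    {r : ℝ | 0 ≤ r ∧ ∃ T : (n : ℕ) → Matrix (Fin n → Fin d) (Fin n → Fin d) ℂ,
      (∀ n, IsTest (T n)) ∧
      (r : EReal) ≤ Filter.liminf (fun n => rate n (typeII (S n) (T n))) Filter.atTop ∧
      Filter.Tendsto (fun n => typeI ρ n (T n)) Filter.atTop (nhds 0)})

/-- The Chernoff exponent `c(ρ‖{S_n})`. -/
def chernoffExp {d : ℕ} (ρ : Matrix (Fin d) (Fin d) ℂ)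
    (S : (n : ℕ) → Set (Matrix (Fin n → Fin d) (Fin n → Fin d) ℂ)) : EReal :=
  Filter.liminf (fun n =>
    rate n (sInf ((fun T => typeI ρ n T + typeII (S n) T) '' {T | IsTest T}))) Filter.atTop

/-- The Hoeffding (direct) exponent `d_r(ρ‖{S_n})`. -/
def hoeffdingExp {d : ℕ} (r : ℝ) (ρ : Matrix (Fin d) (Fin d) ℂ)
    (S : (n : ℕ) → Set (Matrix (Fin n → Fin d) (Fin n → Fin d) ℂ)) : EReal :=
  ⨆ T : {T : (n : ℕ) → Matrix (Fin n → Fin d) (Fin n → Fin d) ℂ //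
      (∀ n, IsTest (T n)) ∧
      (r : EReal) ≤ Filter.liminf (fun n => rate n (typeII (S n) (T n))) Filter.atTop},
    Filter.liminf (fun n => rate n (typeI ρ n (T.1 n))) Filter.atTop

/-- The strong converse exponent `sc_r(ρ‖{S_n})`. -/
def scExp {d : ℕ} (r : ℝ) (ρ : Matrix (Fin d) (Fin d) ℂ)
    (S : (n : ℕ) → Set (Matrix (Fin n → Fin d) (Fin n → Fin d) ℂ)) : EReal :=
  ⨅ T : {T : (n : ℕ) → Matrix (Fin n → Fin d) (Fin n → Fin d) ℂ //
      (∀ n, IsTest (T n)) ∧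
      (r : EReal) ≤ Filter.liminf (fun n => rate n (typeII (S n) (T n))) Filter.atTop},
    Filter.limsup (fun n => rate n (1 - typeI ρ n (T.1 n))) Filter.atTop

/-- Assumption 1 of the paper for a family `{S_n}_{n ≥ 1}` of sets of operators
on `H^{⊗n}`, `H = ℂ^d`: each `S_n` is a convex compact set of positive semidefinite
operators, closed under tensor products, and with polar sets closed under tensor
products. -/
structure Assumption1 {d : ℕ}
    (S : (n : ℕ) → Set (Matrix (Fin n → Fin d) (Fin n → Fin d) ℂ)) : Prop where
  psd : ∀ n, 1 ≤ n → ∀ X ∈ S n, X.PosSemidef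
  convex : ∀ n, 1 ≤ n → Convex ℝ (S n)
  compact : ∀ n, 1 ≤ n → IsCompact (S n)
  tens : ∀ m n, 1 ≤ m → 1 ≤ n → ∀ A ∈ S m, ∀ B ∈ S n, tensOp A B ∈ S (m + n)
  polarTens : ∀ m n, 1 ≤ m → 1 ≤ n →
    ∀ A ∈ polar (S m), ∀ B ∈ polar (S n), tensOp A B ∈ polar (S (m + n))

/-- Assumption 1′ of the paper for a dimension-indexed family `{S_d}_{d ≥ 1}`. -/
structure Assumption1' (S : (d : ℕ) → Set (Matrix (Fin d) (Fin d) ℂ)) : Prop where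
  psd : ∀ d, 1 ≤ d → ∀ X ∈ S d, X.PosSemidef
  convex : ∀ d, 1 ≤ d → Convex ℝ (S d)
  compact : ∀ d, 1 ≤ d → IsCompact (S d)
  tens : ∀ d₁ d₂, 1 ≤ d₁ → 1 ≤ d₂ → ∀ A ∈ S d₁, ∀ B ∈ S d₂, dtens A B ∈ S (d₁ * d₂)
  polarTens : ∀ d₁ d₂, 1 ≤ d₁ → 1 ≤ d₂ →
    ∀ A ∈ polar (S d₁), ∀ B ∈ polar (S d₂), dtens A B ∈ polar (S (d₁ * d₂))

end QHT

set_option linter.unusedSectionVars false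

namespace QHT

section SpectralDecomposition

open Matrix

variable {ι : Type*} [Fintype ι] [DecidableEq ι]

/-- The real power `x ^ s`, with `0` mapped to `0` for every exponent. -/
def pw (x s : ℝ) : ℝ := if x = 0 then 0 else x ^ s

lemma pw_nonneg {x : ℝ} (hx : 0 ≤ x) (s : ℝ) : 0 ≤ pw x s := by
  unfold pw; split_ifs
  · exact le_rfl
  · exact Real.rpow_nonneg hx s

lemma pw_zero_left (s : ℝ) : pw 0 s = 0 := by simp [pw]

lemma pw_of_ne {x : ℝ} (hx : x ≠ 0) (s : ℝ) : pw x s = x ^ s := by simp [pw, hx]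

lemma pw_mul {x y : ℝ} (hx : 0 ≤ x) (hy : 0 ≤ y) (s : ℝ) : pw (x * y) s = pw x s * pw y s := by
  by_cases h : x = 0
  · simp [h, pw_zero_left]
  by_cases h' : y = 0
  · simp [h', pw_zero_left]
  rw [pw_of_ne h, pw_of_ne h', pw_of_ne (mul_ne_zero h h'), Real.mul_rpow hx hy]

/-- A unitary diagonalization of a positive semidefinite matrix. -/
structure SpecDecomp (A U : Matrix ι ι ℂ) (l : ι → ℝ) : Prop where
  unitary : U ∈ Matrix.unitaryGroup ι ℂ
  nonneg : ∀ i, 0 ≤ l i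
  eq : A = U * diagonal (fun i => (l i : ℂ)) * star U

/-- Functional calculus does not depend on the diagonalization. -/
lemma conj_diagonal_comp_eq {U V : Matrix ι ι ℂ} (hU : U ∈ unitaryGroup ι ℂ)
    (hV : V ∈ unitaryGroup ι ℂ) {a b : ι → ℝ}
    (h : U * diagonal (fun i => (a i : ℂ)) * star U = V * diagonal (fun i => (b i : ℂ)) * star V)
    (f : ℝ → ℂ) :
    U * diagonal (fun i => f (a i)) * star U = V * diagonal (fun i => f (b i)) * star V := by
  have hU1 : star U * U = 1 := mem_unitaryGroup_iff'.1 hU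
  have hU2 : U * star U = 1 := mem_unitaryGroup_iff.1 hU
  have hV1 : star V * V = 1 := mem_unitaryGroup_iff'.1 hV
  have hV2 : V * star V = 1 := mem_unitaryGroup_iff.1 hV
  have key : diagonal (fun i => (a i : ℂ)) * (star U * V) =
      (star U * V) * diagonal (fun i => (b i : ℂ)) := by
    calc diagonal (fun i => (a i : ℂ)) * (star U * V)
        = (star U * U) * diagonal (fun i => (a i : ℂ)) * (star U * V) := by rw [hU1, one_mul]
      _ = star U * (U * diagonal (fun i => (a i : ℂ)) * star U) * V := by
          simp only [mul_assoc]
      _ = (star U * V) * diagonal (fun i => (b i : ℂ)) * (star V * V) := by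
          rw [h]; simp only [mul_assoc]
      _ = _ := by rw [hV1, mul_one]
  have key2 : diagonal (fun i => f (a i)) * (star U * V) =
      (star U * V) * diagonal (fun i => f (b i)) := by
    ext i j
    have := congrFun (congrFun key i) j
    rw [diagonal_mul, mul_diagonal] at this ⊢
    by_cases hW : (star U * V) i j = 0
    · simp [hW]
    · rw [mul_comm] at this
      have hab : a i = b j := by exact_mod_cast mul_left_cancel₀ hW this
      rw [hab, mul_comm]
  calc U * diagonal (fun i => f (a i)) * star U
      = U * (diagonal (fun i => f (a i)) * (star U * V)) * star V := by
        simp only [mul_assoc, hV2, mul_one]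
    _ = (U * star U) * V * diagonal (fun i => f (b i)) * star V := by
        rw [key2]; simp only [mul_assoc]
    _ = _ := by rw [hU2, one_mul]

lemma posSemidef_conj_diagonal (U : Matrix ι ι ℂ) {a : ι → ℝ} (ha : ∀ i, 0 ≤ a i) :
    (U * diagonal (fun i => (a i : ℂ)) * star U).PosSemidef := by
  have : (diagonal (fun i => (a i : ℂ))).PosSemidef := by
    rw [posSemidef_diagonal_iff]; intro i; exact_mod_cast ha i
  exact this.mul_mul_conjTranspose_same U

lemma isHermitian_exists_diagonalization {A : Matrix ι ι ℂ} (hA : A.IsHermitian) :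
    A = (hA.eigenvectorUnitary : Matrix ι ι ℂ) * diagonal (fun i => (hA.eigenvalues i : ℂ)) *
      star (hA.eigenvectorUnitary : Matrix ι ι ℂ) := by
  have := hA.spectral_theorem
  rw [Unitary.conjStarAlgAut_apply] at this
  exact this

lemma exists_specDecomp {A : Matrix ι ι ℂ} (hA : A.PosSemidef) :
    ∃ U l, SpecDecomp A U l :=
  ⟨_, _, hA.1.eigenvectorUnitary.2, hA.eigenvalues_nonneg,
    isHermitian_exists_diagonalization hA.1⟩

lemma SpecDecomp.posSemidef {A U : Matrix ι ι ℂ} {l : ι → ℝ} (h : SpecDecomp A U l) :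
    A.PosSemidef := by
  rw [h.eq]; exact posSemidef_conj_diagonal U h.nonneg

lemma ofReal_pw {x : ℝ} (hx : 0 ≤ x) (s : ℝ) :
    ((pw x s : ℝ) : ℂ) = if x = 0 then 0 else (x : ℂ) ^ (s : ℂ) := by
  unfold pw; split_ifs
  · simp
  · rw [Complex.ofReal_cpow hx]

lemma SpecDecomp.mpow_eq {A U : Matrix ι ι ℂ} {l : ι → ℝ} (h : SpecDecomp A U l) (s : ℝ) :
    mpow A (s : ℂ) = U * diagonal (fun i => ((pw (l i) s : ℝ) : ℂ)) * star U := by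
  have hA := h.posSemidef.1
  rw [mpow, dif_pos hA]
  have := conj_diagonal_comp_eq h.unitary hA.eigenvectorUnitary.2
    (h.eq.symm.trans (isHermitian_exists_diagonalization hA))
    (fun x => if x = 0 then 0 else (x : ℂ) ^ (s : ℂ))
  rw [← this]
  simp only [ofReal_pw (h.nonneg _)]

lemma rtr_conj_diagonal_mul (U V : Matrix ι ι ℂ) (a b : ι → ℝ) :
    rtr ((U * diagonal (fun i => (a i : ℂ)) * star U) *
      (V * diagonal (fun i => (b i : ℂ)) * star V)) =
      ∑ i, ∑ j, Complex.normSq ((star U * V) i j) * (a i * b j) := by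
  have h : ((U * diagonal (fun i => (a i : ℂ)) * star U) *
      (V * diagonal (fun i => (b i : ℂ)) * star V)).trace =
      ((diagonal (fun i => (a i : ℂ)) * (star U * V)) *
        (diagonal (fun i => (b i : ℂ)) * star (star U * V))).trace := by
    rw [show (U * diagonal (fun i => (a i : ℂ)) * star U) *
      (V * diagonal (fun i => (b i : ℂ)) * star V) = U * (diagonal (fun i => (a i : ℂ)) * star U *
      (V * diagonal (fun i => (b i : ℂ)) * star V)) by simp only [mul_assoc], trace_mul_comm]
    simp only [star_mul, star_star, mul_assoc]
  rw [rtr, h, trace, Complex.re_sum]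
  refine Finset.sum_congr rfl fun i _ => ?_
  rw [diag_apply, mul_apply, Complex.re_sum]
  refine Finset.sum_congr rfl fun j _ => ?_
  rw [diagonal_mul, diagonal_mul, star_apply, Complex.star_def]
  rw [show (a i : ℂ) * (star U * V) i j * ((b j : ℂ) * (starRingEnd ℂ) ((star U * V) i j)) =
    ((Complex.normSq ((star U * V) i j) * (a i * b j) : ℝ) : ℂ) by
      push_cast [← Complex.mul_conj]; ring]
  exact Complex.ofReal_re _

lemma rtr_mul_nonneg {A B : Matrix ι ι ℂ} (hA : A.PosSemidef) (hB : B.PosSemidef) :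
    0 ≤ rtr (A * B) := by
  obtain ⟨U, l, hU⟩ := exists_specDecomp hA
  obtain ⟨V, m, hV⟩ := exists_specDecomp hB
  rw [hU.eq, hV.eq, rtr_conj_diagonal_mul]
  exact Finset.sum_nonneg fun i _ => Finset.sum_nonneg fun j _ =>
    mul_nonneg (Complex.normSq_nonneg _) (mul_nonneg (hU.nonneg i) (hV.nonneg j))

lemma rtr_add (A B : Matrix ι ι ℂ) : rtr (A + B) = rtr A + rtr B := by
  simp [rtr, trace_add]

lemma rtr_sub (A B : Matrix ι ι ℂ) : rtr (A - B) = rtr A - rtr B := by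
  simp [rtr, trace_sub]

lemma rtr_mul_comm (A B : Matrix ι ι ℂ) : rtr (A * B) = rtr (B * A) := by
  rw [rtr, rtr, trace_mul_comm]

/-- The sum `∑ᵢⱼ |Wᵢⱼ|² lᵢˢ mⱼ¹⁻ˢ`, the classical Rényi quantity of the pair of distributions
`|Wᵢⱼ|² lᵢ` and `|Wᵢⱼ|² mⱼ`. -/
def nsSum (W : Matrix ι ι ℂ) (l m : ι → ℝ) (s : ℝ) : ℝ :=
  ∑ i, ∑ j, Complex.normSq (W i j) * (pw (l i) s * pw (m j) (1 - s))

lemma Qpetz_eq_nsSum {A B U V : Matrix ι ι ℂ} {l m : ι → ℝ} (hA : SpecDecomp A U l)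
    (hB : SpecDecomp B V m) (s : ℝ) : Qpetz s A B = nsSum (star U * V) l m s := by
  rw [Qpetz, hA.mpow_eq, hB.mpow_eq, rtr_conj_diagonal_mul, nsSum]

lemma Qpetz_nonneg {A B : Matrix ι ι ℂ} (hA : A.PosSemidef) (hB : B.PosSemidef) (s : ℝ) :
    0 ≤ Qpetz s A B := by
  obtain ⟨U, l, hU⟩ := exists_specDecomp hA
  obtain ⟨V, m, hV⟩ := exists_specDecomp hB
  rw [Qpetz_eq_nsSum hU hV]
  exact Finset.sum_nonneg fun i _ => Finset.sum_nonneg fun j _ =>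
    mul_nonneg (Complex.normSq_nonneg _)
      (mul_nonneg (pw_nonneg (hU.nonneg i) _) (pw_nonneg (hV.nonneg j) _))

end SpectralDecomposition

end QHT

namespace QHT

section TensorProducts

open Matrix

variable {d m n : ℕ}

lemma tensOp_eq_submatrix (A : Matrix (Fin m → Fin d) (Fin m → Fin d) ℂ)
    (B : Matrix (Fin n → Fin d) (Fin n → Fin d) ℂ) :
    tensOp A B = (kroneckerMap (· * ·) A B).submatrix (Fin.appendEquiv m n).symm
      (Fin.appendEquiv m n).symm := rfl

lemma tensOp_mul (A A' : Matrix (Fin m → Fin d) (Fin m → Fin d) ℂ)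
    (B B' : Matrix (Fin n → Fin d) (Fin n → Fin d) ℂ) :
    tensOp (A * A') (B * B') = tensOp A B * tensOp A' B' := by
  simp only [tensOp_eq_submatrix]
  rw [submatrix_mul_equiv]
  congr 1
  exact mul_kronecker_mul A A' B B'

lemma tensOp_star (A : Matrix (Fin m → Fin d) (Fin m → Fin d) ℂ)
    (B : Matrix (Fin n → Fin d) (Fin n → Fin d) ℂ) :
    tensOp (star A) (star B) = star (tensOp A B) := by
  ext x y
  simp [tensOp, star_apply]

lemma tensOp_diagonal (a : (Fin m → Fin d) → ℂ) (b : (Fin n → Fin d) → ℂ) :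
    tensOp (diagonal a) (diagonal b) = diagonal (fun x =>
      a ((Fin.appendEquiv m n).symm x).1 * b ((Fin.appendEquiv m n).symm x).2) := by
  rw [tensOp_eq_submatrix]
  have h : kroneckerMap (· * ·) (diagonal a) (diagonal b) = _ := diagonal_kronecker_diagonal a b
  rw [h, submatrix_diagonal_equiv]
  rfl

lemma tensOp_one : tensOp (1 : Matrix (Fin m → Fin d) (Fin m → Fin d) ℂ)
    (1 : Matrix (Fin n → Fin d) (Fin n → Fin d) ℂ) = 1 := by
  rw [← diagonal_one, ← diagonal_one, tensOp_diagonal]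
  simp

lemma tensOp_smul_smul (a b : ℂ) (A : Matrix (Fin m → Fin d) (Fin m → Fin d) ℂ)
    (B : Matrix (Fin n → Fin d) (Fin n → Fin d) ℂ) :
    tensOp (a • A) (b • B) = (a * b) • tensOp A B := by
  ext x y
  simp [tensOp]; ring

lemma SpecDecomp.tens {A U : Matrix (Fin m → Fin d) (Fin m → Fin d) ℂ} {l : (Fin m → Fin d) → ℝ}
    {B V : Matrix (Fin n → Fin d) (Fin n → Fin d) ℂ} {k : (Fin n → Fin d) → ℝ}
    (hA : SpecDecomp A U l) (hB : SpecDecomp B V k) :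
    SpecDecomp (tensOp A B) (tensOp U V) (fun x =>
      l ((Fin.appendEquiv m n).symm x).1 * k ((Fin.appendEquiv m n).symm x).2) where
  unitary := by
    rw [mem_unitaryGroup_iff, ← tensOp_star, ← tensOp_mul, mem_unitaryGroup_iff.1 hA.unitary,
      mem_unitaryGroup_iff.1 hB.unitary, tensOp_one]
  nonneg x := mul_nonneg (hA.nonneg _) (hB.nonneg _)
  eq := by
    conv_lhs => rw [hA.eq, hB.eq]
    rw [tensOp_mul, tensOp_mul, tensOp_diagonal, tensOp_star]
    simp only [Complex.ofReal_mul]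

lemma nsSum_tens (W : Matrix (Fin m → Fin d) (Fin m → Fin d) ℂ) (l k : (Fin m → Fin d) → ℝ)
    (W' : Matrix (Fin n → Fin d) (Fin n → Fin d) ℂ) (l' k' : (Fin n → Fin d) → ℝ)
    (hl : ∀ i, 0 ≤ l i) (hk : ∀ i, 0 ≤ k i) (hl' : ∀ i, 0 ≤ l' i) (hk' : ∀ i, 0 ≤ k' i) (s : ℝ) :
    nsSum (tensOp W W')
      (fun x => l ((Fin.appendEquiv m n).symm x).1 * l' ((Fin.appendEquiv m n).symm x).2)
      (fun x => k ((Fin.appendEquiv m n).symm x).1 * k' ((Fin.appendEquiv m n).symm x).2) s =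
      nsSum W l k s * nsSum W' l' k' s := by
  rw [nsSum, ← (Fin.appendEquiv m n).sum_comp, Fintype.sum_prod_type]
  simp_rw [← (Fin.appendEquiv m n).sum_comp, Fintype.sum_prod_type, Equiv.symm_apply_apply,
    pw_mul (hl _) (hl' _), pw_mul (hk _) (hk' _)]
  rw [nsSum, nsSum, Finset.sum_mul_sum]
  refine Finset.sum_congr rfl fun i _ => Finset.sum_congr rfl fun i' _ => ?_
  rw [Finset.sum_mul_sum]
  refine Finset.sum_congr rfl fun j _ => Finset.sum_congr rfl fun j' _ => ?_
  rw [tensOp_eq_submatrix, submatrix_apply, Equiv.symm_apply_apply, Equiv.symm_apply_apply,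
    kroneckerMap_apply, Complex.normSq_mul]
  ring

lemma Qpetz_tens {A B : Matrix (Fin m → Fin d) (Fin m → Fin d) ℂ}
    {A' B' : Matrix (Fin n → Fin d) (Fin n → Fin d) ℂ} (hA : A.PosSemidef) (hB : B.PosSemidef)
    (hA' : A'.PosSemidef) (hB' : B'.PosSemidef) (s : ℝ) :
    Qpetz s (tensOp A A') (tensOp B B') = Qpetz s A B * Qpetz s A' B' := by
  obtain ⟨U, l, hU⟩ := exists_specDecomp hA
  obtain ⟨V, k, hV⟩ := exists_specDecomp hB
  obtain ⟨U', l', hU'⟩ := exists_specDecomp hA'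
  obtain ⟨V', k', hV'⟩ := exists_specDecomp hB'
  rw [Qpetz_eq_nsSum (hU.tens hU') (hV.tens hV'), Qpetz_eq_nsSum hU hV, Qpetz_eq_nsSum hU' hV',
    ← tensOp_star, ← tensOp_mul, nsSum_tens _ _ _ _ _ _ hU.nonneg hV.nonneg hU'.nonneg hV'.nonneg]

lemma tpow_add (ρ : Matrix (Fin d) (Fin d) ℂ) (m n : ℕ) :
    tpow ρ (m + n) = tensOp (tpow ρ m) (tpow ρ n) := by
  ext x y
  simp [tpow, tensOp, Fin.prod_univ_add]

lemma tpow_posSemidef {ρ : Matrix (Fin d) (Fin d) ℂ} (hρ : ρ.PosSemidef) (n : ℕ) :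
    (tpow ρ n).PosSemidef := by
  induction n with
  | zero =>
    have : tpow ρ 0 = 1 := by
      ext x y
      simp [tpow, one_apply, Subsingleton.elim x y]
    rw [this]
    exact PosSemidef.one
  | succ n ih =>
    have h1 : (tpow ρ 1).PosSemidef := by
      have : tpow ρ 1 = ρ.submatrix (fun x => x 0) (fun x => x 0) := by
        ext x y
        simp [tpow]
      rw [this]
      exact hρ.submatrix _
    rw [tpow_add]
    obtain ⟨U, l, hU⟩ := exists_specDecomp ih
    obtain ⟨V, k, hV⟩ := exists_specDecomp h1
    exact (hU.tens hV).posSemidef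

lemma tpow_isState {ρ : Matrix (Fin d) (Fin d) ℂ} (hρ : IsState ρ) (n : ℕ) :
    IsState (tpow ρ n) := by
  refine ⟨tpow_posSemidef hρ.1 n, ?_⟩
  have : (tpow ρ n).trace = ∏ _i : Fin n, ρ.trace := by
    simp only [trace, diag_apply, tpow, of_apply]
    exact (Fintype.prod_sum fun (_ : Fin n) (j : Fin d) => ρ j j).symm
  rw [this, hρ.2]
  simp

end TensorProducts

end QHT

namespace QHT

section OperatorInequalities

open Matrix
open scoped MatrixOrder Matrix.Norms.L2Operator

variable {ι : Type*} [Fintype ι] [DecidableEq ι]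

lemma mpow_eq_rpow {A : Matrix ι ι ℂ} (hA : A.PosSemidef) {s : ℝ} (hs : 0 < s) :
    mpow A (s : ℂ) = A ^ s := by
  rw [CFC.rpow_eq_cfc_real hA.nonneg, hA.1.cfc_eq, IsHermitian.cfc, Unitary.conjStarAlgAut_apply,
    mpow, dif_pos hA.1]
  congr 2
  congr 1
  ext i
  simp only [Function.comp]
  split_ifs with h
  · simp [h, Real.zero_rpow hs.ne']
  · exact (Complex.ofReal_cpow (hA.eigenvalues_nonneg i) s).symm

lemma mpow_posSemidef {A : Matrix ι ι ℂ} (hA : A.PosSemidef) (s : ℝ) :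
    (mpow A (s : ℂ)).PosSemidef := by
  obtain ⟨U, l, hU⟩ := exists_specDecomp hA
  rw [hU.mpow_eq]
  exact posSemidef_conj_diagonal U fun i => pw_nonneg (hU.nonneg i) s

/-- Löwner–Heinz: `A ↦ A ^ s` is operator monotone. -/
lemma mpow_sub_posSemidef {A B : Matrix ι ι ℂ} (hA : A.PosSemidef) (hAB : (B - A).PosSemidef)
    {s : ℝ} (hs : 0 < s) (hs1 : s ≤ 1) : (mpow B (s : ℂ) - mpow A (s : ℂ)).PosSemidef := by
  have hB : B.PosSemidef := by simpa using hA.add hAB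
  rw [mpow_eq_rpow hA hs, mpow_eq_rpow hB hs]
  exact le_iff.1 (CFC.rpow_le_rpow ⟨hs.le, hs1⟩ (le_iff.2 hAB))

/-- `A ↦ A ^ s` is operator concave. -/
lemma mpow_concave {A B : Matrix ι ι ℂ} (hA : A.PosSemidef) (hB : B.PosSemidef)
    {s : ℝ} (hs : 0 < s) (hs1 : s ≤ 1) {a b : ℝ} (ha : 0 ≤ a) (hb : 0 ≤ b) (hab : a + b = 1) :
    (mpow (a • A + b • B) (s : ℂ) - (a • mpow A (s : ℂ) + b • mpow B (s : ℂ))).PosSemidef := by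
  have hc := CFC.concaveOn_rpow (A := Matrix ι ι ℂ) (p := s) ⟨hs.le, hs1⟩
  have h0 : (0 : Matrix ι ι ℂ) ≤ a • A + b • B :=
    (convex_Ici (0 : Matrix ι ι ℂ)) hA.nonneg hB.nonneg ha hb hab
  rw [mpow_eq_rpow hA hs, mpow_eq_rpow hB hs, mpow_eq_rpow h0.posSemidef hs]
  exact le_iff.1 (hc.2 hA.nonneg hB.nonneg ha hb hab)

lemma continuousOn_mpow {s : ℝ} (hs : 0 < s) :
    ContinuousOn (fun A : Matrix ι ι ℂ => mpow A (s : ℂ)) {A | A.PosSemidef} := by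
  have h := CFC.continuousOn_nnrpow (A := Matrix ι ι ℂ) s.toNNReal
  have h2 : {A : Matrix ι ι ℂ | A.PosSemidef} = {A | 0 ≤ A} := by
    ext A; exact nonneg_iff_posSemidef.symm
  rw [h2]
  refine h.congr fun A hA => ?_
  rw [mpow_eq_rpow (LE.le.posSemidef hA) hs]
  simpa [Real.coe_toNNReal s hs.le] using
    (CFC.nnrpow_eq_rpow (a := A) (Real.toNNReal_pos.2 hs)).symm

end OperatorInequalities

end QHT

namespace QHT

section PetzQuantity

open Matrix

variable {ι : Type*} [Fintype ι] [DecidableEq ι]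

lemma rtr_mul_le_of_sub_left {A B C : Matrix ι ι ℂ} (hAB : (B - A).PosSemidef)
    (hC : C.PosSemidef) : rtr (A * C) ≤ rtr (B * C) := by
  have := rtr_mul_nonneg hAB hC
  rw [sub_mul, rtr_sub] at this
  linarith

lemma rtr_mul_le_of_sub_right {A B C : Matrix ι ι ℂ} (hAB : (B - A).PosSemidef)
    (hC : C.PosSemidef) : rtr (C * A) ≤ rtr (C * B) := by
  rw [rtr_mul_comm C A, rtr_mul_comm C B]
  exact rtr_mul_le_of_sub_left hAB hC

lemma Qpetz_self {A : Matrix ι ι ℂ} (hA : A.PosSemidef) (s : ℝ) : Qpetz s A A = rtr A := by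
  obtain ⟨U, l, hU⟩ := exists_specDecomp hA
  rw [Qpetz, hU.mpow_eq, hU.mpow_eq]
  have h1 : star U * U = 1 := mem_unitaryGroup_iff'.1 hU.unitary
  have : (U * diagonal (fun i => ((pw (l i) s : ℝ) : ℂ)) * star U) *
      (U * diagonal (fun i => ((pw (l i) (1 - s) : ℝ) : ℂ)) * star U) = A := by
    rw [show (U * diagonal (fun i => ((pw (l i) s : ℝ) : ℂ)) * star U) *
      (U * diagonal (fun i => ((pw (l i) (1 - s) : ℝ) : ℂ)) * star U) =
      U * (diagonal (fun i => ((pw (l i) s : ℝ) : ℂ)) * (star U * U) *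
        diagonal (fun i => ((pw (l i) (1 - s) : ℝ) : ℂ))) * star U by simp only [mul_assoc],
      h1, mul_one, diagonal_mul_diagonal, hU.eq]
    congr 3
    ext i
    by_cases h : l i = 0
    · simp [h, pw_zero_left]
    · rw [pw_of_ne h, pw_of_ne h, ← Complex.ofReal_mul, ← Real.rpow_add
        (lt_of_le_of_ne (hU.nonneg i) (Ne.symm h))]
      simp
  rw [this]

lemma Qpetz_mono {A A' B B' : Matrix ι ι ℂ} (hA : A.PosSemidef) (hA' : (A' - A).PosSemidef)
    (hB : B.PosSemidef) (hB' : (B' - B).PosSemidef) {s : ℝ} (hs : s ∈ Ioo (0 : ℝ) 1) :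
    Qpetz s A B ≤ Qpetz s A' B' := by
  have hA'' : A'.PosSemidef := by simpa using hA.add hA'
  exact (rtr_mul_le_of_sub_left (mpow_sub_posSemidef hA hA' hs.1 hs.2.le)
      (mpow_posSemidef hB _)).trans
    (rtr_mul_le_of_sub_right (mpow_sub_posSemidef hB hB' (by linarith [hs.2]) (by linarith [hs.1]))
      (mpow_posSemidef hA'' _))

lemma Qpetz_le_add {A B : Matrix ι ι ℂ} (hA : A.PosSemidef) (hB : B.PosSemidef) {s : ℝ}
    (hs : s ∈ Ioo (0 : ℝ) 1) : Qpetz s A B ≤ rtr A + rtr B := by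
  have h := Qpetz_mono (A' := A + B) (B' := A + B) hA (by simpa using hB) hB (by simpa using hA) hs
  rwa [Qpetz_self (hA.add hB), rtr_add] at h

/-- Audenaert's inequality: some test has total error at most `Tr[A ^ s B ^ (1 - s)]`. -/
lemma exists_isTest_error_le_Qpetz {A B : Matrix ι ι ℂ} (hA : A.PosSemidef) (hB : B.PosSemidef) :
    ∃ T, IsTest T ∧ ∀ s ∈ Ioo (0 : ℝ) 1, rtr ((1 - T) * A) + rtr (B * T) ≤ Qpetz s A B := by
  have hD : (A - B).IsHermitian := hA.1.sub hB.1
  set U : Matrix ι ι ℂ := (hD.eigenvectorUnitary : Matrix ι ι ℂ)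
  set a := hD.eigenvalues
  have hUm : U ∈ unitaryGroup ι ℂ := hD.eigenvectorUnitary.2
  have hU : star U * U = 1 := mem_unitaryGroup_iff'.1 hUm
  have hU' : U * star U = 1 := mem_unitaryGroup_iff.1 hUm
  have hDeq : A - B = U * diagonal (fun i => (a i : ℂ)) * star U :=
    isHermitian_exists_diagonalization hD
  set T := U * diagonal (fun i => ((if 0 < a i then 1 else 0 : ℝ) : ℂ)) * star U with hT
  set P := U * diagonal (fun i => ((max (a i) 0 : ℝ) : ℂ)) * star U with hP
  have hPpsd : P.PosSemidef := posSemidef_conj_diagonal U fun i => le_max_right _ _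
  have hPD : (P - (A - B)).PosSemidef := by
    have : P - (A - B) = U * diagonal (fun i => ((max (a i) 0 - a i : ℝ) : ℂ)) * star U := by
      rw [hDeq, hP, ← sub_mul, ← mul_sub, diagonal_sub]
      simp only [Complex.ofReal_sub]
    rw [this]
    exact posSemidef_conj_diagonal U fun i => sub_nonneg.2 (le_max_left _ _)
  have hTest : IsTest T := by
    refine ⟨posSemidef_conj_diagonal U fun i => by split_ifs <;> simp, ?_⟩
    have : 1 - T = U * diagonal (fun i => ((1 - (if 0 < a i then 1 else 0) : ℝ) : ℂ)) * star U := by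
      have h1 : (1 : Matrix ι ι ℂ) = U * Matrix.diagonal (fun _ => 1) * star U := by
        rw [diagonal_one, mul_one, hU']
      conv_lhs => rw [h1]
      rw [hT, ← sub_mul, ← mul_sub, diagonal_sub]
      simp only [Complex.ofReal_sub, Complex.ofReal_one]
    rw [this]
    exact posSemidef_conj_diagonal U fun i => by split_ifs <;> simp
  have hTD : T * (A - B) = P := by
    rw [hDeq, hT, hP, show (U * diagonal (fun i => ((if 0 < a i then 1 else 0 : ℝ) : ℂ)) * star U) *
      (U * diagonal (fun i => (a i : ℂ)) * star U) =
      U * (diagonal (fun i => ((if 0 < a i then 1 else 0 : ℝ) : ℂ)) * (star U * U) *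
        diagonal (fun i => (a i : ℂ))) * star U by simp only [mul_assoc],
      hU, mul_one, diagonal_mul_diagonal]
    congr 3
    ext i
    split_ifs with h
    · simp [max_eq_left h.le]
    · simp [max_eq_right (not_lt.1 h)]
  refine ⟨T, hTest, fun s hs => ?_⟩
  have hs' : 1 - s ∈ Ioo (0 : ℝ) 1 := ⟨by linarith [hs.2], by linarith [hs.1]⟩
  have herr : rtr ((1 - T) * A) + rtr (B * T) = rtr A - rtr P := by
    rw [← hTD, sub_mul, one_mul, mul_sub, rtr_sub, rtr_sub, rtr_mul_comm B T]
    ring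
  set E := B + P
  have hE : E.PosSemidef := hB.add hPpsd
  have hEA : (E - A).PosSemidef := by
    rwa [show E - A = P - (A - B) by simp only [E]; abel]
  have hEB : (E - B).PosSemidef := by simpa [E] using hPpsd
  have hmB := mpow_sub_posSemidef hB hEB hs'.1 hs'.2.le
  have h1 : rtr A ≤ rtr (mpow A (s : ℂ) * mpow E ((1 - s : ℝ) : ℂ)) := by
    rw [← Qpetz_self hA s]
    exact rtr_mul_le_of_sub_right (mpow_sub_posSemidef hA hEA hs'.1 hs'.2.le)
      (mpow_posSemidef hA s)
  have h2 := rtr_mul_le_of_sub_left (mpow_sub_posSemidef hA hEA hs.1 hs.2.le) hmB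
  have h3 : rtr B ≤ rtr (mpow E (s : ℂ) * mpow B ((1 - s : ℝ) : ℂ)) := by
    rw [← Qpetz_self hB s]
    exact rtr_mul_le_of_sub_left (mpow_sub_posSemidef hB hEB hs.1 hs.2.le) (mpow_posSemidef hB _)
  have h4 : rtr (mpow E (s : ℂ) * mpow E ((1 - s : ℝ) : ℂ)) = rtr B + rtr P := by
    have := Qpetz_self hE s
    rwa [Qpetz, rtr_add] at this
  rw [mul_sub, mul_sub, rtr_sub, rtr_sub] at h2
  rw [herr, Qpetz]
  linarith

lemma Qpetz_concave {A B B' : Matrix ι ι ℂ} (hA : A.PosSemidef) (hB : B.PosSemidef)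
    (hB' : B'.PosSemidef) {s : ℝ} (hs : s ∈ Ioo (0 : ℝ) 1) {a b : ℝ} (ha : 0 ≤ a) (hb : 0 ≤ b)
    (hab : a + b = 1) :
    a * Qpetz s A B + b * Qpetz s A B' ≤ Qpetz s A (a • B + b • B') := by
  have h := rtr_mul_le_of_sub_right (mpow_concave hB hB' (s := 1 - s) (by linarith [hs.2])
    (by linarith [hs.1]) ha hb hab) (mpow_posSemidef hA s)
  rw [mul_add, rtr_add] at h
  refine le_trans (le_of_eq ?_) h
  simp [Qpetz, rtr]

lemma continuousOn_Qpetz (A : Matrix ι ι ℂ) {s : ℝ} (hs : s < 1) :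
    ContinuousOn (fun B => Qpetz s A B) {B | B.PosSemidef} := by
  have h := continuousOn_mpow (ι := ι) (s := 1 - s) (by linarith)
  have hc : Continuous fun M : Matrix ι ι ℂ => rtr (mpow A (s : ℂ) * M) := by
    unfold rtr; fun_prop
  exact hc.comp_continuousOn h

end PetzQuantity

section Support

open Matrix

variable {ι : Type*} [Fintype ι] [DecidableEq ι]

lemma trace_mul_eq_ofReal_rtr {A B : Matrix ι ι ℂ} (hA : A.PosSemidef) (hB : B.PosSemidef) :
    (A * B).trace = (rtr (A * B) : ℂ) := by
  have h : star (A * B).trace = (A * B).trace := by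
    rw [← trace_conjTranspose, conjTranspose_mul, hA.1.eq, hB.1.eq, trace_mul_comm]
  exact (Complex.conj_eq_iff_re.1 h).symm

lemma SpecDecomp.trace_mul_eq_zero_iff {A B U V : Matrix ι ι ℂ} {l m : ι → ℝ}
    (hA : SpecDecomp A U l) (hB : SpecDecomp B V m) :
    (A * B).trace = 0 ↔ ∀ i j, Complex.normSq ((star U * V) i j) * (l i * m j) = 0 := by
  rw [trace_mul_eq_ofReal_rtr hA.posSemidef hB.posSemidef, Complex.ofReal_eq_zero]
  conv_lhs => rw [hA.eq, hB.eq, rtr_conj_diagonal_mul]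
  have h0 : ∀ i j, 0 ≤ Complex.normSq ((star U * V) i j) * (l i * m j) := fun i j =>
    mul_nonneg (Complex.normSq_nonneg _) (mul_nonneg (hA.nonneg i) (hB.nonneg j))
  rw [Finset.sum_eq_zero_iff_of_nonneg fun i _ => Finset.sum_nonneg fun j _ => h0 i j]
  simp only [Finset.mem_univ, true_implies]
  refine forall_congr' fun i => ?_
  rw [Finset.sum_eq_zero_iff_of_nonneg fun j _ => h0 i j]
  simp

lemma Qpetz_eq_zero {A B : Matrix ι ι ℂ} (hA : A.PosSemidef) (hB : B.PosSemidef)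
    (h : (A * B).trace = 0) (s : ℝ) : Qpetz s A B = 0 := by
  obtain ⟨U, l, hU⟩ := exists_specDecomp hA
  obtain ⟨V, m, hV⟩ := exists_specDecomp hB
  rw [Qpetz_eq_nsSum hU hV]
  refine Finset.sum_eq_zero fun i _ => Finset.sum_eq_zero fun j _ => ?_
  have := (hU.trace_mul_eq_zero_iff hV).1 h i j
  simp only [mul_eq_zero] at this
  rcases this with h | h | h <;> simp [h, pw_zero_left]

lemma min_le_pw_mul_pw {x y s : ℝ} (hx : 0 ≤ x) (hy : 0 ≤ y) (hs : s ∈ Icc (0 : ℝ) 1) :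
    min x y ≤ pw x s * pw y (1 - s) := by
  by_cases hx0 : x = 0
  · simp [hx0, pw_zero_left]
  by_cases hy0 : y = 0
  · simp [hy0, pw_zero_left]
  have hx' : 0 < x := lt_of_le_of_ne hx (Ne.symm hx0)
  have hy' : 0 < y := lt_of_le_of_ne hy (Ne.symm hy0)
  have hm : 0 < min x y := lt_min hx' hy'
  rw [pw_of_ne hx0, pw_of_ne hy0]
  calc min x y = min x y ^ s * min x y ^ (1 - s) := by
        rw [← Real.rpow_add hm]; simp
    _ ≤ x ^ s * y ^ (1 - s) := mul_le_mul
        (Real.rpow_le_rpow hm.le (min_le_left _ _) hs.1)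
        (Real.rpow_le_rpow hm.le (min_le_right _ _) (by linarith [hs.2]))
        (Real.rpow_nonneg hm.le _) (Real.rpow_nonneg hx _)

lemma exists_pos_le_Qpetz {A B : Matrix ι ι ℂ} (hA : A.PosSemidef) (hB : B.PosSemidef)
    (h : (A * B).trace ≠ 0) : ∃ c > 0, ∀ s ∈ Icc (0 : ℝ) 1, c ≤ Qpetz s A B := by
  obtain ⟨U, l, hU⟩ := exists_specDecomp hA
  obtain ⟨V, m, hV⟩ := exists_specDecomp hB
  rw [ne_eq, hU.trace_mul_eq_zero_iff hV] at h
  push Not at h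
  obtain ⟨i, j, hij⟩ := h
  simp only [mul_ne_zero_iff] at hij
  refine ⟨Complex.normSq ((star U * V) i j) * min (l i) (m j), ?_, fun s hs => ?_⟩
  · exact mul_pos (lt_of_le_of_ne (Complex.normSq_nonneg _) (Ne.symm hij.1))
      (lt_min (lt_of_le_of_ne (hU.nonneg i) (Ne.symm hij.2.1))
        (lt_of_le_of_ne (hV.nonneg j) (Ne.symm hij.2.2)))
  · rw [Qpetz_eq_nsSum hU hV, nsSum]
    have h0 : ∀ i j, 0 ≤ Complex.normSq ((star U * V) i j) * (pw (l i) s * pw (m j) (1 - s)) :=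
      fun i j => mul_nonneg (Complex.normSq_nonneg _)
        (mul_nonneg (pw_nonneg (hU.nonneg i) _) (pw_nonneg (hV.nonneg j) _))
    refine le_trans ?_ (Finset.single_le_sum (fun i _ => Finset.sum_nonneg fun j _ => h0 i j)
      (Finset.mem_univ i))
    refine le_trans ?_ (Finset.single_le_sum (fun j _ => h0 i j) (Finset.mem_univ j))
    exact mul_le_mul_of_nonneg_left (min_le_pw_mul_pw (hU.nonneg i) (hV.nonneg j) hs)
      (Complex.normSq_nonneg _)

lemma trace_mul_ne_zero_of_msupp_le {A B : Matrix ι ι ℂ} (hA : A.PosSemidef) (hA0 : A ≠ 0)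
    (hB : B.PosSemidef) (h : msupp A ≤ msupp B) : (A * B).trace ≠ 0 := by
  intro htr
  have hAB : A * B = 0 := by
    obtain ⟨U, l, hU⟩ := exists_specDecomp hA
    obtain ⟨V, m, hV⟩ := exists_specDecomp hB
    have h0 := (hU.trace_mul_eq_zero_iff hV).1 htr
    have hz : diagonal (fun i => (l i : ℂ)) * (star U * V) * diagonal (fun i => (m i : ℂ)) = 0 := by
      ext i j
      rw [mul_diagonal, diagonal_mul]
      have := h0 i j
      simp only [mul_eq_zero, Complex.normSq_eq_zero] at this
      rcases this with h | h | h <;> simp [h]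
    rw [hU.eq, hV.eq, show U * diagonal (fun i => (l i : ℂ)) * star U *
      (V * diagonal (fun i => (m i : ℂ)) * star V) = U * (diagonal (fun i => (l i : ℂ)) *
      (star U * V) * diagonal (fun i => (m i : ℂ))) * star V by simp only [mul_assoc], hz]
    simp
  have hBA : B * A = 0 := by
    have := congrArg conjTranspose hAB
    rwa [conjTranspose_mul, hA.1.eq, hB.1.eq, conjTranspose_zero] at this
  apply hA0
  have hv : ∀ v, A *ᵥ v = 0 := by
    intro v
    obtain ⟨w, hw⟩ := h ⟨v, rfl⟩
    simp only [mulVecLin_apply] at hw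
    have : star (B *ᵥ w) ⬝ᵥ A *ᵥ v = 0 := by
      rw [star_mulVec, ← dotProduct_mulVec, hB.1.eq, mulVec_mulVec, hBA, zero_mulVec,
        dotProduct_zero]
    rw [hw] at this
    exact dotProduct_star_self_eq_zero.1 this
  exact ext_of_mulVec_single fun i => by rw [hv, zero_mulVec]

lemma IsState.ne_zero {A : Matrix ι ι ℂ} (hA : IsState A) : A ≠ 0 := by
  rintro rfl
  simpa using hA.2

/-- `(1 - α) D_α = - log Q_α`, including the infinite case. -/
lemma one_sub_mul_Dpetz {A B : Matrix ι ι ℂ} (hA : IsState A) (hB : B.PosSemidef) {α : ℝ}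
    (hα : α ∈ Ioo (0 : ℝ) 1) : ((1 - α : ℝ) : EReal) * Dpetz α A B = negLog (Qpetz α A B) := by
  have h1 : 0 < 1 - α := by linarith [hα.2]
  rw [Dpetz]
  split_ifs with h
  · have htr : (A * B).trace ≠ 0 := by
      rcases h with h | h
      · exact h.2
      · exact trace_mul_ne_zero_of_msupp_le hA.1 hA.ne_zero hB h
    obtain ⟨c, hc, hcQ⟩ := exists_pos_le_Qpetz hA.1 hB htr
    have hQ : 0 < Qpetz α A B := hc.trans_le (hcQ α ⟨hα.1.le, hα.2.le⟩)
    rw [negLog, if_neg (not_le.2 hQ), ← EReal.coe_mul]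
    congr 1
    have h2 : α - 1 ≠ 0 := by linarith
    field_simp
    ring
  · push Not at h
    have htr := h.1 hα.2
    rw [Qpetz_eq_zero hA.1 hB htr, negLog, if_pos le_rfl, EReal.coe_mul_top_of_pos h1]

end Support

end QHT

namespace QHT

section Minimax

open Matrix

/-- Sion's minimax theorem, in a form without suprema and infima. -/
lemma exists_forall_lt_of_forall_exists_lt {E F : Type*} [TopologicalSpace E] [AddCommGroup E]
    [Module ℝ E] [IsTopologicalAddGroup E] [ContinuousSMul ℝ E] [TopologicalSpace F]
    [AddCommGroup F] [Module ℝ F] [IsTopologicalAddGroup F] [ContinuousSMul ℝ F]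
    {X : Set E} {Y : Set F} {f : E → F → ℝ} (hX : X.Nonempty) (hXc : IsCompact X)
    (hXconv : Convex ℝ X) (hYconv : Convex ℝ Y)
    (hfy : ∀ y ∈ Y, ContinuousOn (fun x => f x y) X)
    (hfy' : ∀ y ∈ Y, ConvexOn ℝ X (fun x => f x y))
    (hfx : ∀ x ∈ X, ContinuousOn (f x) Y) (hfx' : ∀ x ∈ X, ConcaveOn ℝ Y (f x)) {t : ℝ}
    (h : ∀ x ∈ X, ∃ y ∈ Y, t < f x y) : ∃ y ∈ Y, ∀ x ∈ X, t < f x y := by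
  have hl : ∀ y ∈ Y, LowerSemicontinuousOn (fun x => f x y) X := fun y hy =>
    (hfy y hy).lowerSemicontinuousOn
  have : ∃ s : Finset Y, ∀ x ∈ X, ∃ i ∈ s, t < f x i := by
    rw [← LowerSemicontinuousOn.inter_biInter_preimage_Iic_eq_empty_iff_exists_finset hXc hl]
    apply Set.eq_empty_of_forall_notMem
    rintro x ⟨hx, hx'⟩
    simp only [mem_iInter, mem_preimage, mem_Iic] at hx'
    obtain ⟨y, hy, hty⟩ := h x hx
    exact absurd (hx' y hy) (not_le.2 hty)
  obtain ⟨s, hs⟩ := this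
  refine Sion.exists_lt_iInf_of_lt_iInf_of_finite hX hXc hl (fun y hy => (hfy' y hy).quasiconvexOn)
    hYconv (fun x hx => (hfx x hx).upperSemicontinuousOn)
    (fun x hx => (hfx' x hx).quasiconcaveOn) hXconv (s.finite_toSet.image Subtype.val)
    (Subtype.coe_image_subset Y _) fun x hx => ?_
  obtain ⟨i, hi, hi'⟩ := hs x hx
  exact ⟨i, mem_image_of_mem _ hi, hi'⟩

variable {ι : Type*} [Fintype ι] [DecidableEq ι]

lemma pw_mul_pw_eq_exp {x y : ℝ} (hx : 0 < x) (hy : 0 < y) (s : ℝ) :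
    pw x s * pw y (1 - s) = Real.exp (Real.log y + s * (Real.log x - Real.log y)) := by
  rw [pw_of_ne hx.ne', pw_of_ne hy.ne', Real.rpow_def_of_pos hx, Real.rpow_def_of_pos hy,
    ← Real.exp_add]
  congr 1
  ring

lemma pw_mul_pw_eq_zero_or_exp {x y : ℝ} (hx : 0 ≤ x) (hy : 0 ≤ y) :
    (fun s => pw x s * pw y (1 - s)) = 0 ∨
    (fun s => pw x s * pw y (1 - s)) =
      fun s => Real.exp (Real.log y + s * (Real.log x - Real.log y)) := by
  rcases hx.eq_or_lt with rfl | hx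
  · left; ext s; simp [pw_zero_left]
  rcases hy.eq_or_lt with rfl | hy
  · left; ext s; simp [pw_zero_left]
  · right; ext s; exact pw_mul_pw_eq_exp hx hy s

lemma differentiable_nsSum (W : Matrix ι ι ℂ) {l m : ι → ℝ} (hl : ∀ i, 0 ≤ l i)
    (hm : ∀ i, 0 ≤ m i) : Differentiable ℝ (nsSum W l m) := by
  unfold nsSum
  refine Differentiable.fun_sum fun i _ => Differentiable.fun_sum fun j _ =>
    Differentiable.const_mul ?_ _
  rcases pw_mul_pw_eq_zero_or_exp (hl i) (hm j) with h | h <;> rw [h]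
  · exact differentiable_const _
  · fun_prop

lemma convexOn_nsSum (W : Matrix ι ι ℂ) {l m : ι → ℝ} (hl : ∀ i, 0 ≤ l i)
    (hm : ∀ i, 0 ≤ m i) : ConvexOn ℝ univ (nsSum W l m) := by
  have hterm : ∀ i j, ConvexOn ℝ univ (fun s => pw (l i) s * pw (m j) (1 - s)) := by
    intro i j
    rcases pw_mul_pw_eq_zero_or_exp (hl i) (hm j) with h | h <;> rw [h]
    · exact convexOn_const 0 convex_univ
    · refine ⟨convex_univ, fun x _ y _ a b ha hb hab => ?_⟩
      have := convexOn_exp.2 (mem_univ (Real.log (m j) + x * (Real.log (l i) - Real.log (m j))))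
        (mem_univ (Real.log (m j) + y * (Real.log (l i) - Real.log (m j)))) ha hb hab
      refine le_trans (le_of_eq ?_) this
      simp only [smul_eq_mul]
      congr 1
      linear_combination (-Real.log (m j)) * hab
  refine ⟨convex_univ, fun x _ y _ a b ha hb hab => ?_⟩
  simp only [nsSum, smul_eq_mul, Finset.mul_sum]
  simp only [← Finset.sum_add_distrib]
  refine Finset.sum_le_sum fun i _ => Finset.sum_le_sum fun j _ => ?_
  have h := mul_le_mul_of_nonneg_left ((hterm i j).2 (mem_univ x) (mem_univ y) ha hb hab)
    (Complex.normSq_nonneg (W i j))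
  simp only [smul_eq_mul] at h
  linarith

lemma exists_Qpetz_lt_of_forall_exists {S : Set (Matrix ι ι ℂ)} (hne : S.Nonempty)
    (hS : IsCompact S) (hconv : Convex ℝ S) (hpsd : ∀ σ ∈ S, σ.PosSemidef) {A : Matrix ι ι ℂ}
    (hA : A.PosSemidef) {t : ℝ} (h : ∀ σ ∈ S, ∃ α ∈ Ioo (0 : ℝ) 1, Qpetz α A σ < t) :
    ∃ α ∈ Ioo (0 : ℝ) 1, ∀ σ ∈ S, Qpetz α A σ < t := by
  have key := exists_forall_lt_of_forall_exists_lt (X := S) (Y := Ioo (0 : ℝ) 1)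
    (f := fun σ α => - Qpetz α A σ) (t := -t) hne hS hconv (convex_Ioo 0 1)
    (fun α hα => ((continuousOn_Qpetz A hα.2).mono hpsd).neg)
    (fun α hα => ⟨hconv, fun σ hσ σ' hσ' a b ha hb hab => by
      have := Qpetz_concave hA (hpsd σ hσ) (hpsd σ' hσ') hα ha hb hab
      simp only [smul_eq_mul]; linarith⟩)
    (fun σ hσ => by
      obtain ⟨U, l, hU⟩ := exists_specDecomp hA
      obtain ⟨V, m, hV⟩ := exists_specDecomp (hpsd σ hσ)
      simp_rw [Qpetz_eq_nsSum hU hV]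
      exact (differentiable_nsSum _ hU.nonneg hV.nonneg).continuous.neg.continuousOn)
    (fun σ hσ => by
      obtain ⟨U, l, hU⟩ := exists_specDecomp hA
      obtain ⟨V, m, hV⟩ := exists_specDecomp (hpsd σ hσ)
      simp_rw [Qpetz_eq_nsSum hU hV]
      exact ((convexOn_nsSum _ hU.nonneg hV.nonneg).subset (subset_univ _) (convex_Ioo 0 1)).neg)
    (fun σ hσ => by
      obtain ⟨α, hα, h⟩ := h σ hσ
      exact ⟨α, hα, neg_lt_neg h⟩)
  obtain ⟨α, hα, h⟩ := key
  exact ⟨α, hα, fun σ hσ => neg_lt_neg_iff.1 (h σ hσ)⟩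

lemma convex_setOf_isTest : Convex ℝ {T : Matrix ι ι ℂ | IsTest T} := by
  intro T hT T' hT' a b ha hb hab
  refine ⟨(hT.1.smul ha).add (hT'.1.smul hb), ?_⟩
  have : 1 - (a • T + b • T') = a • (1 - T) + b • (1 - T') := by
    rw [smul_sub, smul_sub]
    have : (1 : Matrix ι ι ℂ) = a • 1 + b • 1 := by rw [← add_smul, hab, one_smul]
    conv_lhs => rw [this]
    abel
  rw [this]
  exact (hT.2.smul ha).add (hT'.2.smul hb)

lemma rtr_smul (a : ℝ) (A : Matrix ι ι ℂ) : rtr (a • A) = a * rtr A := by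
  simp [rtr, trace_smul]

lemma exists_isTest_lt_of_forall_exists {S : Set (Matrix ι ι ℂ)} (hne : S.Nonempty)
    (hS : IsCompact S) (hconv : Convex ℝ S) (A : Matrix ι ι ℂ) {t : ℝ}
    (h : ∀ σ ∈ S, ∃ T, IsTest T ∧ rtr ((1 - T) * A) + rtr (σ * T) < t) :
    ∃ T, IsTest T ∧ ∀ σ ∈ S, rtr ((1 - T) * A) + rtr (σ * T) < t := by
  have key := exists_forall_lt_of_forall_exists_lt (X := S) (Y := {T | IsTest T})
    (f := fun σ T => - (rtr ((1 - T) * A) + rtr (σ * T))) (t := -t) hne hS hconv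
    convex_setOf_isTest
    (fun T _ => by unfold rtr; fun_prop)
    (fun T _ => ⟨hconv, fun σ _ σ' _ a b ha hb hab => le_of_eq (by
      simp only [smul_eq_mul, add_mul, smul_mul_assoc, rtr_add, rtr_smul]
      linear_combination (rtr ((1 - T) * A)) * hab)⟩)
    (fun σ _ => by unfold rtr; fun_prop)
    (fun σ _ => ⟨convex_setOf_isTest, fun T _ T' _ a b ha hb hab => le_of_eq (by
      simp only [smul_eq_mul, mul_add, add_mul, sub_mul, one_mul, mul_smul_comm, smul_mul_assoc,
        rtr_add, rtr_sub, rtr_smul]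
      linear_combination (-rtr A) * hab)⟩)
    (fun σ hσ => by
      obtain ⟨T, hT, h⟩ := h σ hσ
      exact ⟨T, hT, neg_lt_neg h⟩)
  obtain ⟨T, hT, h⟩ := key
  exact ⟨T, hT, fun σ hσ => neg_lt_neg_iff.1 (h σ hσ)⟩

end Minimax

end QHT

namespace QHT

section NussbaumSzkola

open Matrix

variable {ι : Type*} [Fintype ι] [DecidableEq ι]

/-- The sum `∑ᵢⱼ |Wᵢⱼ|² min lᵢ mⱼ`, the classical error of the pair of distributions
`|Wᵢⱼ|² lᵢ` and `|Wᵢⱼ|² mⱼ`. -/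
def minSum (W : Matrix ι ι ℂ) (l m : ι → ℝ) : ℝ :=
  ∑ i, ∑ j, Complex.normSq (W i j) * min (l i) (m j)

lemma IsTest.sub_mul_self {T : Matrix ι ι ℂ} (hT : IsTest T) : (T - T * T).PosSemidef := by
  have h1 := hT.2.mul_mul_conjTranspose_same T
  have h2 := hT.1.mul_mul_conjTranspose_same (1 - T)
  rw [hT.1.1.eq] at h1
  rw [hT.2.1.eq] at h2
  have : T - T * T = T * (1 - T) * T + (1 - T) * T * (1 - T) := by noncomm_ring
  rw [this]
  exact h1.add h2

lemma IsTest.one_sub {T : Matrix ι ι ℂ} (hT : IsTest T) : IsTest (1 - T) :=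
  ⟨hT.2, by simpa using hT.1⟩

lemma IsTest.rtr_mul_ge {A T U V : Matrix ι ι ℂ} {m : ι → ℝ} (hT : IsTest T)
    (hA : SpecDecomp A V m) (hU : U ∈ unitaryGroup ι ℂ) :
    ∑ i, ∑ j, Complex.normSq ((star U * T * V) i j) * m j ≤ rtr (T * A) := by
  have h := rtr_mul_le_of_sub_left hT.sub_mul_self hA.posSemidef
  refine le_trans (le_of_eq ?_) h
  have h1 := rtr_conj_diagonal_mul U (T * V) (fun _ => 1) m
  have hUU : U * Matrix.diagonal (fun _ : ι => ((1 : ℝ) : ℂ)) * star U = 1 := by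
    rw [Complex.ofReal_one, diagonal_one, mul_one, mem_unitaryGroup_iff.1 hU]
  rw [hUU, one_mul, star_mul, star_eq_conjTranspose T, hT.1.1.eq,
    show T * V * Matrix.diagonal (fun i => (m i : ℂ)) * (star V * T) =
      T * (V * Matrix.diagonal (fun i => (m i : ℂ)) * star V) * T by simp only [mul_assoc],
    ← hA.eq, rtr_mul_comm, ← mul_assoc] at h1
  rw [h1]
  simp only [one_mul, mul_assoc]

lemma normSq_add_le (a b : ℂ) :
    Complex.normSq (a + b) ≤ 2 * (Complex.normSq a + Complex.normSq b) := by
  simp only [Complex.normSq_apply, Complex.add_re, Complex.add_im]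
  nlinarith [sq_nonneg (a.re - b.re), sq_nonneg (a.im - b.im)]

/-- The Nussbaum–Szkoła bound: no test for a pair of operators has a smaller error than half the
classical error of the associated pair of distributions. -/
lemma IsTest.half_minSum_le {A B T U V : Matrix ι ι ℂ} {l m : ι → ℝ} (hT : IsTest T)
    (hA : SpecDecomp A U l) (hB : SpecDecomp B V m) :
    minSum (star U * V) l m / 2 ≤ rtr ((1 - T) * A) + rtr (B * T) := by
  have h1 := hT.rtr_mul_ge hB hA.unitary
  have h2 := hT.one_sub.rtr_mul_ge hA hB.unitary
  rw [Finset.sum_comm] at h2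
  rw [rtr_mul_comm B T]
  refine le_trans ?_ (add_le_add h2 h1)
  rw [minSum, Finset.sum_div, ← Finset.sum_add_distrib]
  refine Finset.sum_le_sum fun i _ => ?_
  rw [Finset.sum_div, ← Finset.sum_add_distrib]
  refine Finset.sum_le_sum fun j _ => ?_
  have hflip : Complex.normSq ((star V * (1 - T) * U) j i) =
      Complex.normSq ((star U * (1 - T) * V) i j) := by
    rw [← Complex.normSq_conj ((star U * (1 - T) * V) i j)]
    have : star V * (1 - T) * U = star (star U * (1 - T) * V) := by
      rw [star_mul, star_mul, star_star, star_eq_conjTranspose (1 - T), hT.2.1.eq, mul_assoc]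
    rw [this]
    rfl
  have hsum : (star U * V) i j = (star U * (1 - T) * V) i j + (star U * T * V) i j := by
    rw [← Matrix.add_apply, ← add_mul, ← mul_add, sub_add_cancel, mul_one]
  rw [hflip, hsum]
  have hn := normSq_add_le ((star U * (1 - T) * V) i j) ((star U * T * V) i j)
  have h0 : 0 ≤ min (l i) (m j) := le_min (hA.nonneg i) (hB.nonneg j)
  have ha := mul_le_mul_of_nonneg_left (min_le_left (l i) (m j))
    (Complex.normSq_nonneg ((star U * (1 - T) * V) i j))
  have hb := mul_le_mul_of_nonneg_left (min_le_right (l i) (m j))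
    (Complex.normSq_nonneg ((star U * T * V) i j))
  have := mul_le_mul_of_nonneg_right hn h0
  linarith

end NussbaumSzkola

section ClassicalChernoff

open Matrix

variable {ι : Type*} [Fintype ι] [DecidableEq ι]

lemma pw_mul_pw_le {x y α K δ : ℝ} (hx : 0 ≤ x) (hy : 0 ≤ y) (hα : α ∈ Icc (0 : ℝ) 1)
    (hK : 0 ≤ K) (hδ : 0 ≤ δ) :
    pw x α * pw y (1 - α) ≤ Real.exp K * min x y +
      (if α = 0 then min x y
        else Real.exp (-(K * δ)) * (pw x (α + δ) * pw y (1 - (α + δ)))) +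
      (if α = 1 then min x y
        else Real.exp (-(K * δ)) * (pw x (α - δ) * pw y (1 - (α - δ)))) := by
  have hmin : 0 ≤ min x y := le_min hx hy
  have hp : ∀ s, 0 ≤ pw x s * pw y (1 - s) := fun s => mul_nonneg (pw_nonneg hx _) (pw_nonneg hy _)
  have h1 : 0 ≤ Real.exp K * min x y := mul_nonneg (Real.exp_pos _).le hmin
  have h2 : 0 ≤ (if α = 0 then min x y
        else Real.exp (-(K * δ)) * (pw x (α + δ) * pw y (1 - (α + δ)))) := by
    split_ifs
    exacts [hmin, mul_nonneg (Real.exp_pos _).le (hp _)]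
  have h3 : 0 ≤ (if α = 1 then min x y
        else Real.exp (-(K * δ)) * (pw x (α - δ) * pw y (1 - (α - δ)))) := by
    split_ifs
    exacts [hmin, mul_nonneg (Real.exp_pos _).le (hp _)]
  rcases hx.eq_or_lt with rfl | hx'
  · simp only [pw_zero_left, zero_mul] at *; linarith
  rcases hy.eq_or_lt with rfl | hy'
  · simp only [pw_zero_left, mul_zero] at *; linarith
  simp only [pw_mul_pw_eq_exp hx' hy'] at *
  set r := Real.log x - Real.log y with hr
  have hxe : Real.exp (Real.log y + r) = x := by rw [hr]; simp [Real.exp_log hx']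
  have hye : Real.exp (Real.log y) = y := Real.exp_log hy'
  have hmin_pos : 0 ≤ r → min x y = y := fun h => min_eq_right (by
    rw [← hxe, ← hye, Real.log_exp, Real.exp_le_exp]; linarith)
  have hmin_neg : r ≤ 0 → min x y = x := fun h => min_eq_left (by
    rw [← hxe]; conv_rhs => rw [← hye]
    rw [Real.exp_le_exp]; linarith)
  rcases lt_or_ge K r with hrK | hrK
  · have hX : Real.exp (Real.log y + α * r) ≤ (if α = 0 then min x y
        else Real.exp (-(K * δ)) * Real.exp (Real.log y + (α + δ) * r)) := by
      split_ifs with h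
      · rw [hmin_pos (hK.trans hrK.le), h, zero_mul, add_zero, hye]
      · rw [← Real.exp_add, Real.exp_le_exp]
        nlinarith
    linarith
  rcases lt_or_ge r (-K) with hrK' | hrK'
  · have hX : Real.exp (Real.log y + α * r) ≤ (if α = 1 then min x y
        else Real.exp (-(K * δ)) * Real.exp (Real.log y + (α - δ) * r)) := by
      split_ifs with h
      · rw [hmin_neg (by linarith), h, one_mul, hxe]
      · rw [← Real.exp_add, Real.exp_le_exp]
        nlinarith
    linarith
  have hX : Real.exp (Real.log y + α * r) ≤ Real.exp K * min x y := by
    rcases le_total 0 r with h | h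
    · rw [hmin_pos h]
      conv_rhs => rw [← hye]
      rw [← Real.exp_add, Real.exp_le_exp]
      nlinarith [hα.1, hα.2]
    · rw [hmin_neg h, ← hxe, ← Real.exp_add, Real.exp_le_exp]
      nlinarith [hα.1, hα.2]
  linarith

lemma nsSum_le {W : Matrix ι ι ℂ} {l m : ι → ℝ} {α K δ : ℝ} (hl : ∀ i, 0 ≤ l i)
    (hm : ∀ i, 0 ≤ m i) (hα : α ∈ Icc (0 : ℝ) 1) (hK : 0 ≤ K) (hδ : 0 ≤ δ) :
    nsSum W l m α ≤ Real.exp K * minSum W l m +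
      (if α = 0 then minSum W l m else Real.exp (-(K * δ)) * nsSum W l m (α + δ)) +
      (if α = 1 then minSum W l m else Real.exp (-(K * δ)) * nsSum W l m (α - δ)) := by
  have h : ∀ i j, Complex.normSq (W i j) * (pw (l i) α * pw (m j) (1 - α)) ≤ _ := fun i j =>
    mul_le_mul_of_nonneg_left (pw_mul_pw_le (hl i) (hm j) hα hK hδ) (Complex.normSq_nonneg (W i j))
  refine (Finset.sum_le_sum fun i _ => Finset.sum_le_sum fun j _ => h i j).trans (le_of_eq ?_)
  simp only [mul_add, Finset.sum_add_distrib]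
  congr 1
  · congr 1
    · simp only [minSum, Finset.mul_sum]
      exact Finset.sum_congr rfl fun i _ => Finset.sum_congr rfl fun j _ => by ring
    · split_ifs
      · rfl
      · simp only [nsSum, Finset.mul_sum]
        exact Finset.sum_congr rfl fun i _ => Finset.sum_congr rfl fun j _ => by ring
  · split_ifs
    · rfl
    · simp only [nsSum, Finset.mul_sum]
      exact Finset.sum_congr rfl fun i _ => Finset.sum_congr rfl fun j _ => by ring

lemma le_minSum_of_growth_le {W : Matrix ι ι ℂ} {l m : ι → ℝ} {α K δ : ℝ} (hl : ∀ i, 0 ≤ l i)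
    (hm : ∀ i, 0 ≤ m i) (hα : α ∈ Icc (0 : ℝ) 1) (hK : 0 ≤ K) (hδ : 0 ≤ δ)
    (hr : α ≠ 0 → Real.exp (-(K * δ)) * nsSum W l m (α + δ) ≤ nsSum W l m α / 4)
    (hl' : α ≠ 1 → Real.exp (-(K * δ)) * nsSum W l m (α - δ) ≤ nsSum W l m α / 4) :
    Real.exp (-K) * nsSum W l m α / 6 ≤ minSum W l m := by
  have h := nsSum_le (W := W) hl hm hα hK hδ
  have hF : 0 ≤ minSum W l m := Finset.sum_nonneg fun i _ => Finset.sum_nonneg fun j _ =>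
    mul_nonneg (Complex.normSq_nonneg _) (le_min (hl i) (hm j))
  have hG : 0 ≤ nsSum W l m α := Finset.sum_nonneg fun i _ => Finset.sum_nonneg fun j _ =>
    mul_nonneg (Complex.normSq_nonneg _) (mul_nonneg (pw_nonneg (hl i) _) (pw_nonneg (hm j) _))
  have hF' : minSum W l m ≤ Real.exp K * minSum W l m :=
    le_mul_of_one_le_left hF (Real.one_le_exp hK)
  have h6 : nsSum W l m α ≤ 6 * (Real.exp K * minSum W l m) := by
    have h1 : (if α = 0 then minSum W l m else Real.exp (-(K * δ)) * nsSum W l m (α + δ)) ≤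
        Real.exp K * minSum W l m + nsSum W l m α / 4 := by
      split_ifs with h0
      · linarith
      · linarith [hr h0]
    have h2 : (if α = 1 then minSum W l m else Real.exp (-(K * δ)) * nsSum W l m (α - δ)) ≤
        Real.exp K * minSum W l m + nsSum W l m α / 4 := by
      split_ifs with h0
      · linarith
      · linarith [hl' h0]
    linarith
  calc Real.exp (-K) * nsSum W l m α / 6
      ≤ Real.exp (-K) * (6 * (Real.exp K * minSum W l m)) / 6 := by gcongr
    _ = (Real.exp (-K) * Real.exp K) * minSum W l m := by ring
    _ = minSum W l m := by rw [← Real.exp_add]; simp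

/-- Right of a point that is not above its left neighbours, a differentiable function grows
slower than any exponential. -/
lemma eventually_le_exp_mul {g : ℝ → ℝ} {α η : ℝ} (hg : DifferentiableAt ℝ g α) (hpos : 0 < g α)
    (hη : 0 < η) (hmin : ∀ x, 0 < x → x < η → g α ≤ g (α - x)) {ε : ℝ} (hε : 0 < ε) :
    ∀ᶠ δ in nhdsWithin 0 (Ioi (0 : ℝ)), g (α + δ) ≤ Real.exp (ε * δ) * g α := by
  have hd := hasDerivAt_iff_isLittleO_nhds_zero.1 hg.hasDerivAt
  set g' := deriv g α
  have hg' : g' ≤ 0 := by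
    by_contra! hlt
    have h1 := hd.def (half_pos hlt)
    have h2 : ∀ᶠ x in nhdsWithin 0 (Ioi (0 : ℝ)), g α ≤ g (α - x) ∧
        ‖g (α + -x) - g α - (-x) • g'‖ ≤ g' / 2 * ‖-x‖ ∧ 0 < x := by
      have hneg : Tendsto (fun x : ℝ => -x) (nhdsWithin 0 (Ioi (0 : ℝ))) (nhds 0) := by
        have : Tendsto (fun x : ℝ => -x) (nhds 0) (nhds (-0)) := continuous_neg.tendsto 0
        rw [neg_zero] at this
        exact this.mono_left nhdsWithin_le_nhds
      filter_upwards [Ioo_mem_nhdsGT hη, hneg.eventually h1] with x hx hx2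
      exact ⟨hmin x hx.1 hx.2, hx2, hx.1⟩
    obtain ⟨x, hx1, hx2, hx3⟩ := h2.exists
    rw [Real.norm_eq_abs, Real.norm_eq_abs, abs_neg, abs_of_pos hx3, abs_le, ← sub_eq_add_neg,
      smul_eq_mul] at hx2
    nlinarith [hx2.2, mul_pos hx3 hlt]
  have h1 := (hd.def (mul_pos hε hpos)).filter_mono (nhdsWithin_le_nhds (s := Ioi (0 : ℝ)))
  filter_upwards [h1, self_mem_nhdsWithin] with δ hδ hδ0
  rw [mem_Ioi] at hδ0
  rw [Real.norm_eq_abs, Real.norm_eq_abs, abs_of_pos hδ0, abs_le, smul_eq_mul] at hδ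
  have h3 : (ε * δ + 1) * g α ≤ Real.exp (ε * δ) * g α :=
    mul_le_mul_of_nonneg_right (Real.add_one_le_exp _) hpos.le
  nlinarith [hδ.2, mul_nonneg hδ0.le (neg_nonneg.2 hg')]

/-- At a minimizer over `[0, 1]`, a differentiable positive function grows slower than any
exponential in the directions that do not leave `[0, 1]` through an end point. -/
lemma exists_le_exp_mul_of_isMinOn {g : ℝ → ℝ} (hg : Differentiable ℝ g) {α : ℝ}
    (hα : α ∈ Icc (0 : ℝ) 1) (hmin : ∀ s ∈ Icc (0 : ℝ) 1, g α ≤ g s) (hpos : 0 < g α) {ε : ℝ}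
    (hε : 0 < ε) : ∃ δ > 0, (α ≠ 0 → g (α + δ) ≤ Real.exp (ε * δ) * g α) ∧
      (α ≠ 1 → g (α - δ) ≤ Real.exp (ε * δ) * g α) := by
  have h1 : ∀ᶠ δ in nhdsWithin 0 (Ioi (0 : ℝ)),
      α ≠ 0 → g (α + δ) ≤ Real.exp (ε * δ) * g α := by
    by_cases h : α = 0
    · simp [h]
    have h0 : 0 < α := lt_of_le_of_ne hα.1 (Ne.symm h)
    filter_upwards [eventually_le_exp_mul hg.differentiableAt hpos h0
      (fun x hx hx' => hmin _ ⟨by linarith, by linarith [hα.2]⟩) hε] with δ hδ _ using hδ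
  have h2 : ∀ᶠ δ in nhdsWithin 0 (Ioi (0 : ℝ)),
      α ≠ 1 → g (α - δ) ≤ Real.exp (ε * δ) * g α := by
    by_cases h : α = 1
    · simp [h]
    have h0 : 0 < 1 - α := by linarith [lt_of_le_of_ne hα.2 h]
    have hg' : Differentiable ℝ (fun x => g (-x)) := hg.comp differentiable_neg
    filter_upwards [eventually_le_exp_mul (g := fun x => g (-x)) (α := -α)
      hg'.differentiableAt (by simpa using hpos) h0
      (fun x hx hx' => by
        rw [neg_neg]
        exact hmin _ ⟨by linarith [hα.1], by linarith⟩) hε] with δ hδ _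
    rw [neg_neg, show -(-α + δ) = α - δ by ring] at hδ
    exact hδ
  obtain ⟨δ, hδ, hδ1, hδ2⟩ := (eventually_mem_nhdsWithin.and (h1.and h2)).exists
  exact ⟨δ, hδ, hδ1, hδ2⟩

lemma le_on_Icc_of_le_on_Ioo {g : ℝ → ℝ} (hg : Continuous g) {c : ℝ}
    (hc : ∀ s ∈ Ioo (0 : ℝ) 1, c ≤ g s) : ∀ s ∈ Icc (0 : ℝ) 1, c ≤ g s := by
  have hcl : IsClosed {s | c ≤ g s} := isClosed_le continuous_const hg
  have := hcl.closure_subset_iff.2 (show Ioo (0 : ℝ) 1 ⊆ {s | c ≤ g s} from hc)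
  rwa [closure_Ioo zero_ne_one] at this

lemma exp_mul_pow_le {x y ε δ : ℝ} {k : ℕ} (hx : 0 ≤ x) (hy : 0 ≤ y)
    (h : x ≤ Real.exp (ε / 2 * δ) * y) (hk : Real.exp (-(ε / 2 * δ)) ^ k ≤ 1 / 4) :
    Real.exp (-(ε * k * δ)) * x ^ k ≤ y ^ k / 4 :=
  calc Real.exp (-(ε * k * δ)) * x ^ k
      ≤ Real.exp (-(ε * k * δ)) * (Real.exp (ε / 2 * δ) * y) ^ k :=
        mul_le_mul_of_nonneg_left (pow_le_pow_left₀ hx h k) (Real.exp_pos _).le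
    _ = Real.exp (-(ε / 2 * δ)) ^ k * y ^ k := by
        rw [mul_pow, ← mul_assoc, ← Real.exp_nat_mul, ← Real.exp_nat_mul, ← Real.exp_add]
        congr 2
        ring
    _ ≤ 1 / 4 * y ^ k := mul_le_mul_of_nonneg_right hk (pow_nonneg hy k)
    _ = y ^ k / 4 := by ring

/-- The converse part of the Chernoff bound, for operators behaving like tensor powers of a given
pair. -/
lemma exists_le_error_of_Qpetz_eq_pow {A B : Matrix ι ι ℂ} (hA : A.PosSemidef)
    (hB : B.PosSemidef) {c : ℝ} (hc : 0 < c) (hcQ : ∀ s ∈ Ioo (0 : ℝ) 1, c ≤ Qpetz s A B) {ε : ℝ}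
    (hε : 0 < ε) : ∃ k₀ : ℕ, ∀ k ≥ k₀, ∀ (κ : Type) [Fintype κ] [DecidableEq κ]
      (A' B' T : Matrix κ κ ℂ), A'.PosSemidef → B'.PosSemidef →
      (∀ s, Qpetz s A' B' = Qpetz s A B ^ k) → IsTest T →
      Real.exp (-(ε * k)) * c ^ k / 12 ≤ rtr ((1 - T) * A') + rtr (B' * T) := by
  obtain ⟨U, l, hU⟩ := exists_specDecomp hA
  obtain ⟨V, m, hV⟩ := exists_specDecomp hB
  obtain ⟨g, hgdef⟩ : ∃ g : ℝ → ℝ, ∀ s, g s = Qpetz s A B := ⟨_, fun _ => rfl⟩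
  have hgeq : g = nsSum (star U * V) l m := by
    ext s; rw [hgdef, Qpetz_eq_nsSum hU hV]
  have hgd : Differentiable ℝ g := by
    rw [hgeq]; exact differentiable_nsSum _ hU.nonneg hV.nonneg
  obtain ⟨α, hα, hmin⟩ := isCompact_Icc.exists_isMinOn (nonempty_Icc.2 (zero_le_one' ℝ))
    hgd.continuous.continuousOn
  have hcα : c ≤ g α := le_on_Icc_of_le_on_Ioo hgd.continuous
    (fun s hs => (hcQ s hs).trans_eq (hgdef s).symm) α hα
  have hgα : 0 < g α := hc.trans_le hcα
  obtain ⟨δ, hδ, hδ1, hδ2⟩ := exists_le_exp_mul_of_isMinOn hgd hα (fun s hs => hmin hs) hgα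
    (half_pos hε)
  have hlim : Tendsto (fun k : ℕ => Real.exp (-(ε / 2 * δ)) ^ k) atTop (nhds 0) :=
    tendsto_pow_atTop_nhds_zero_of_lt_one (Real.exp_pos _).le
      (Real.exp_lt_one_iff.2 (neg_lt_zero.2 (mul_pos (half_pos hε) hδ)))
  obtain ⟨k₀, hk₀⟩ := eventually_atTop.1 (hlim.eventually_le_const (show (0 : ℝ) < 1 / 4 by norm_num))
  refine ⟨k₀, fun k hk κ _ _ A' B' T hA' hB' hQ hT => ?_⟩
  obtain ⟨U', l', hU'⟩ := exists_specDecomp hA'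
  obtain ⟨V', m', hV'⟩ := exists_specDecomp hB'
  have hns : ∀ s, nsSum (star U' * V') l' m' s = g s ^ k := fun s => by
    rw [← Qpetz_eq_nsSum hU' hV', hQ, hgdef]
  have hg0 : ∀ s, 0 ≤ g s := fun s => (Qpetz_nonneg hA hB s).trans_eq (hgdef s).symm
  have hstep : ∀ s, g s ≤ Real.exp (ε / 2 * δ) * g α →
      Real.exp (-(ε * k * δ)) * g s ^ k ≤ g α ^ k / 4 :=
    fun s hs => exp_mul_pow_le (hg0 s) hgα.le hs (hk₀ k hk)
  have hF := le_minSum_of_growth_le (W := star U' * V') (K := ε * k) (δ := δ) hU'.nonneg hV'.nonneg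
    hα (by positivity) hδ.le
    (fun h => by rw [hns, hns]; exact hstep _ (hδ1 h))
    (fun h => by rw [hns, hns]; exact hstep _ (hδ2 h))
  rw [hns] at hF
  refine le_trans ?_ (hT.half_minSum_le hU' hV')
  have : Real.exp (-(ε * k)) * c ^ k ≤ Real.exp (-(ε * k)) * g α ^ k :=
    mul_le_mul_of_nonneg_left (pow_le_pow_left₀ hc.le hcα k) (Real.exp_pos _).le
  linarith

end ClassicalChernoff

end QHT

namespace QHT

section MaxMin

open Matrix

variable {ι : Type*} [Fintype ι] [DecidableEq ι]

/-- The infimum of `Tr[A^α B^{1-α}]` over `α ∈ (0, 1)`, the Chernoff quantity of `A` and `B`. -/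
def infQpetz (A B : Matrix ι ι ℂ) : ℝ := ⨅ α : Ioo (0 : ℝ) 1, Qpetz α A B

/-- The supremum over `B ∈ S` of the Chernoff quantity of `A` and `B`. -/
def supInfQpetz (A : Matrix ι ι ℂ) (S : Set (Matrix ι ι ℂ)) : ℝ := sSup (infQpetz A '' S)

variable {A B : Matrix ι ι ℂ} {S : Set (Matrix ι ι ℂ)}

lemma infQpetz_le (hA : A.PosSemidef) (hB : B.PosSemidef) {α : ℝ} (hα : α ∈ Ioo (0 : ℝ) 1) :
    infQpetz A B ≤ Qpetz α A B :=
  ciInf_le (f := fun α : Ioo (0 : ℝ) 1 => Qpetz α A B)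
    ⟨0, by rintro _ ⟨s, rfl⟩; exact Qpetz_nonneg hA hB s⟩ ⟨α, hα⟩

instance : Nonempty (Ioo (0 : ℝ) 1) := ⟨⟨1 / 2, by norm_num, by norm_num⟩⟩

lemma le_infQpetz {c : ℝ} (h : ∀ α ∈ Ioo (0 : ℝ) 1, c ≤ Qpetz α A B) : c ≤ infQpetz A B :=
  le_ciInf fun α => h α α.2

lemma infQpetz_nonneg (hA : A.PosSemidef) (hB : B.PosSemidef) : 0 ≤ infQpetz A B :=
  le_infQpetz fun α _ => Qpetz_nonneg hA hB α

lemma infQpetz_le_add (hA : A.PosSemidef) (hB : B.PosSemidef) :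
    infQpetz A B ≤ rtr A + rtr B :=
  have h : (1 / 2 : ℝ) ∈ Ioo (0 : ℝ) 1 := ⟨by norm_num, by norm_num⟩
  (infQpetz_le hA hB h).trans (Qpetz_le_add hA hB h)

lemma exists_Qpetz_lt {t : ℝ} (h : infQpetz A B < t) : ∃ α ∈ Ioo (0 : ℝ) 1, Qpetz α A B < t :=
  let ⟨α, hα⟩ := exists_lt_of_ciInf_lt h
  ⟨α, α.2, hα⟩

lemma continuous_rtr_mul_right (T : Matrix ι ι ℂ) : Continuous fun σ : Matrix ι ι ℂ => rtr (σ * T) :=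
  Complex.continuous_re.comp (continuous_id.matrix_mul continuous_const).matrix_trace

lemma bddAbove_rtr_mul (hS : IsCompact S) (T : Matrix ι ι ℂ) :
    BddAbove ((fun σ => rtr (σ * T)) '' S) :=
  (hS.image (continuous_rtr_mul_right T)).bddAbove

lemma exists_one_le_rtr_le (hS : IsCompact S) : ∃ C ≥ (1 : ℝ), ∀ σ ∈ S, rtr σ ≤ C := by
  obtain ⟨C, hC⟩ := bddAbove_rtr_mul hS 1
  refine ⟨max C 1, le_max_right _ _, fun σ hσ => le_max_of_le_left ?_⟩
  simpa using hC ⟨σ, hσ, rfl⟩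

lemma le_supInfQpetz (hA : A.PosSemidef) (hS : IsCompact S) (hpsd : ∀ σ ∈ S, σ.PosSemidef)
    (hB : B ∈ S) : infQpetz A B ≤ supInfQpetz A S := by
  obtain ⟨C, -, hC⟩ := exists_one_le_rtr_le hS
  refine le_csSup ⟨rtr A + C, ?_⟩ ⟨B, hB, rfl⟩
  rintro _ ⟨σ, hσ, rfl⟩
  exact (infQpetz_le_add hA (hpsd σ hσ)).trans (by linarith [hC σ hσ])

lemma exists_lt_infQpetz (hne : S.Nonempty) {t : ℝ} (h : t < supInfQpetz A S) :
    ∃ σ ∈ S, t < infQpetz A σ := by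
  obtain ⟨_, ⟨σ, hσ, rfl⟩, h⟩ := exists_lt_of_lt_csSup (hne.image _) h
  exact ⟨σ, hσ, h⟩

end MaxMin

section Exponents

open Matrix

variable {ι : Type*} [Fintype ι] [DecidableEq ι] {A : Matrix ι ι ℂ} {S : Set (Matrix ι ι ℂ)}

lemma negLog_le {x y : ℝ} (h : Real.exp (-y) ≤ x) : negLog x ≤ y := by
  have hx : 0 < x := (Real.exp_pos _).trans_le h
  rw [negLog, if_neg hx.not_ge, EReal.coe_le_coe_iff]
  linarith [(Real.le_log_iff_exp_le hx).2 h]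

lemma le_negLog {x y : ℝ} (h : x ≤ Real.exp (-y)) : (y : EReal) ≤ negLog x := by
  rw [negLog]
  split_ifs with hx
  · exact le_top
  · rw [EReal.coe_le_coe_iff]
    linarith [(Real.log_le_iff_le_exp (not_le.1 hx)).2 h]

lemma rate_le {n : ℕ} (hn : 1 ≤ n) {x y : ℝ} (h : Real.exp (-(n * y)) ≤ x) : rate n x ≤ y := by
  have hn' : (0 : ℝ) < n := by exact_mod_cast hn
  calc rate n x ≤ ((n : ℝ)⁻¹ : ℝ) * ((n * y : ℝ) : EReal) :=
        mul_le_mul_of_nonneg_left (negLog_le h) (EReal.coe_nonneg.2 (inv_nonneg.2 hn'.le))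
    _ = y := by rw [← EReal.coe_mul, inv_mul_cancel_left₀ hn'.ne']

lemma le_rate {n : ℕ} (hn : 1 ≤ n) {x y : ℝ} (h : x ≤ Real.exp (-(n * y))) :
    (y : EReal) ≤ rate n x := by
  have hn' : (0 : ℝ) < n := by exact_mod_cast hn
  calc (y : EReal) = ((n : ℝ)⁻¹ : ℝ) * ((n * y : ℝ) : EReal) := by
        rw [← EReal.coe_mul, inv_mul_cancel_left₀ hn'.ne']
    _ ≤ rate n x :=
        mul_le_mul_of_nonneg_left (le_negLog h) (EReal.coe_nonneg.2 (inv_nonneg.2 hn'.le))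

/-- For a compact convex set, both the sup-inf and the inf-sup of `(1 - α) D_α` are minus the
logarithm of the largest Chernoff quantity. -/
lemma iSup_iInf_Dpetz_and_iInf_iSup_Dpetz (hA : IsState A) (hne : S.Nonempty) (hS : IsCompact S)
    (hconv : Convex ℝ S) (hpsd : ∀ σ ∈ S, σ.PosSemidef) (hpos : 0 < supInfQpetz A S) :
    ⨆ α ∈ Ioo (0 : ℝ) 1, ⨅ σ ∈ S, ((1 - α : ℝ) : EReal) * Dpetz α A σ =
        ((-Real.log (supInfQpetz A S) : ℝ) : EReal) ∧
      ⨅ σ ∈ S, ⨆ α ∈ Ioo (0 : ℝ) 1, ((1 - α : ℝ) : EReal) * Dpetz α A σ =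
        ((-Real.log (supInfQpetz A S) : ℝ) : EReal) := by
  have hle : ⨆ α ∈ Ioo (0 : ℝ) 1, ⨅ σ ∈ S, ((1 - α : ℝ) : EReal) * Dpetz α A σ ≤
      ⨅ σ ∈ S, ⨆ α ∈ Ioo (0 : ℝ) 1, ((1 - α : ℝ) : EReal) * Dpetz α A σ :=
    iSup₂_le fun α hα => le_iInf₂ fun σ hσ =>
      (iInf₂_le σ hσ).trans (le_iSup₂ (f := fun (α : ℝ) (_ : α ∈ Ioo (0 : ℝ) 1) =>
        ((1 - α : ℝ) : EReal) * Dpetz α A σ) α hα)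
  have hupper : ⨅ σ ∈ S, ⨆ α ∈ Ioo (0 : ℝ) 1, ((1 - α : ℝ) : EReal) * Dpetz α A σ ≤
      ((-Real.log (supInfQpetz A S) : ℝ) : EReal) := by
    refine EReal.le_of_forall_lt_iff_le.1 fun y hy => ?_
    rw [EReal.coe_lt_coe_iff, neg_lt] at hy
    obtain ⟨σ, hσ, hlt⟩ := exists_lt_infQpetz hne ((Real.lt_log_iff_exp_lt hpos).1 hy)
    refine (iInf₂_le σ hσ).trans (iSup₂_le fun α hα => ?_)
    rw [one_sub_mul_Dpetz hA (hpsd σ hσ) hα]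
    exact negLog_le (hlt.le.trans (infQpetz_le hA.1 (hpsd σ hσ) hα))
  have hlower : ((-Real.log (supInfQpetz A S) : ℝ) : EReal) ≤
      ⨆ α ∈ Ioo (0 : ℝ) 1, ⨅ σ ∈ S, ((1 - α : ℝ) : EReal) * Dpetz α A σ := by
    refine EReal.ge_of_forall_gt_iff_ge.1 fun y hy => ?_
    rw [EReal.coe_lt_coe_iff, lt_neg] at hy
    obtain ⟨α, hα, h⟩ := exists_Qpetz_lt_of_forall_exists hne hS hconv hpsd hA.1
      (t := Real.exp (-y)) fun σ hσ => exists_Qpetz_lt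
        ((le_supInfQpetz hA.1 hS hpsd hσ).trans_lt ((Real.log_lt_iff_lt_exp hpos).1 hy))
    refine le_iSup₂_of_le α hα (le_iInf₂ fun σ hσ => ?_)
    rw [one_sub_mul_Dpetz hA (hpsd σ hσ) hα]
    exact le_negLog (h σ hσ).le
  exact ⟨(hle.trans hupper).antisymm hlower, hupper.antisymm (hlower.trans hle)⟩

/-- The smallest total error of a test for `A` against the set `S`. -/
def minError (A : Matrix ι ι ℂ) (S : Set (Matrix ι ι ℂ)) : ℝ :=
  sInf ((fun T => rtr ((1 - T) * A) + sSup ((fun σ => rtr (σ * T)) '' S)) '' {T | IsTest T})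

lemma minError_le_supInfQpetz (hA : A.PosSemidef) (hne : S.Nonempty) (hS : IsCompact S)
    (hconv : Convex ℝ S) (hpsd : ∀ σ ∈ S, σ.PosSemidef) : minError A S ≤ supInfQpetz A S := by
  refine le_of_forall_gt_imp_ge_of_dense fun t ht => ?_
  obtain ⟨T, hT, h⟩ := exists_isTest_lt_of_forall_exists hne hS hconv A (t := t) fun σ hσ => by
    obtain ⟨α, hα, hlt⟩ := exists_Qpetz_lt ((le_supInfQpetz hA hS hpsd hσ).trans_lt ht)
    obtain ⟨T, hT, h⟩ := exists_isTest_error_le_Qpetz hA (hpsd σ hσ)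
    exact ⟨T, hT, (h α hα).trans_lt hlt⟩
  have hsup : sSup ((fun σ => rtr (σ * T)) '' S) ≤ t - rtr ((1 - T) * A) := by
    refine csSup_le (hne.image _) ?_
    rintro _ ⟨σ, hσ, rfl⟩
    linarith [h σ hσ]
  have hT' : minError A S ≤ rtr ((1 - T) * A) + sSup ((fun σ => rtr (σ * T)) '' S) :=
    csInf_le ⟨0, ?_⟩ ⟨T, hT, rfl⟩
  · linarith
  rintro _ ⟨T', hT', rfl⟩
  refine add_nonneg (rtr_mul_nonneg hT'.2 hA) (Real.sSup_nonneg ?_)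
  rintro _ ⟨σ, hσ, rfl⟩
  exact rtr_mul_nonneg (hpsd σ hσ) hT'.1

lemma le_minError (hS : IsCompact S) {σ : Matrix ι ι ℂ} (hσ : σ ∈ S) {e : ℝ}
    (h : ∀ T, IsTest T → e ≤ rtr ((1 - T) * A) + rtr (σ * T)) : e ≤ minError A S := by
  refine le_csInf ⟨_, 0, ⟨PosSemidef.zero, by simpa using PosSemidef.one⟩, rfl⟩ ?_
  rintro _ ⟨T, hT, rfl⟩
  exact (h T hT).trans
    (add_le_add_right (le_csSup (bddAbove_rtr_mul hS T) ⟨σ, hσ, rfl⟩) _)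

end Exponents

section Regularization

open Matrix

variable {d : ℕ} {ρ : Matrix (Fin d) (Fin d) ℂ}
  {S : (n : ℕ) → Set (Matrix (Fin n → Fin d) (Fin n → Fin d) ℂ)}

lemma Assumption1.exists_Qpetz_eq_pow (hS : Assumption1 S) (hρ : ρ.PosSemidef) {m : ℕ}
    (hm : 1 ≤ m) {σ : Matrix (Fin m → Fin d) (Fin m → Fin d) ℂ} (hσ : σ ∈ S m) {k : ℕ}
    (hk : 1 ≤ k) : ∃ σ' ∈ S (m * k),
      ∀ s, Qpetz s (tpow ρ (m * k)) σ' = Qpetz s (tpow ρ m) σ ^ k := by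
  induction k, hk using Nat.le_induction with
  | base =>
    simp only [pow_one]
    rw [mul_one]
    exact ⟨σ, hσ, fun s => rfl⟩
  | succ k hk ih =>
    obtain ⟨σ', hσ', h⟩ := ih
    have hmk : 1 ≤ m * k := Nat.mul_pos hm hk
    refine ⟨tensOp σ' σ, hS.tens _ _ hmk hm _ hσ' _ hσ, fun s => ?_⟩
    rw [pow_succ, ← h s, ← Qpetz_tens (tpow_posSemidef hρ _) (hS.psd _ hmk _ hσ')
      (tpow_posSemidef hρ _) (hS.psd _ hm _ hσ), ← tpow_add]
    rfl

lemma Assumption1.pow_le_supInfQpetz (hS : Assumption1 S) (hρ : ρ.PosSemidef) {c : ℝ}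
    (hc : 0 < c) {τ : Matrix (Fin 1 → Fin d) (Fin 1 → Fin d) ℂ} (hτ : τ ∈ S 1)
    (h : ∀ s ∈ Ioo (0 : ℝ) 1, c ≤ Qpetz s (tpow ρ 1) τ) {n : ℕ} (hn : 1 ≤ n) :
    c ^ n ≤ supInfQpetz (tpow ρ n) (S n) := by
  have hex := hS.exists_Qpetz_eq_pow hρ le_rfl hτ hn
  rw [one_mul] at hex
  obtain ⟨σ, hσ, hQ⟩ := hex
  refine le_trans ?_ (le_supInfQpetz (tpow_posSemidef hρ n) (hS.compact n hn) (hS.psd n hn) hσ)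
  exact le_infQpetz fun s hs => by rw [hQ]; exact pow_le_pow_left₀ hc.le (h s hs) n

lemma Assumption1.nonempty (hS : Assumption1 S) (h1 : (S 1).Nonempty) {n : ℕ} (hn : 1 ≤ n) :
    (S n).Nonempty := by
  induction n, hn using Nat.le_induction with
  | base => exact h1
  | succ n hn ih =>
    obtain ⟨σ, hσ⟩ := ih
    obtain ⟨τ, hτ⟩ := h1
    exact ⟨_, hS.tens _ _ hn le_rfl _ hσ _ hτ⟩

/-- Supermultiplicativity of the largest Chernoff quantity. -/
lemma Assumption1.mul_supInfQpetz_le (hS : Assumption1 S) (hρ : ρ.PosSemidef)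
    (h1 : (S 1).Nonempty) {m n : ℕ} (hm : 1 ≤ m) (hn : 1 ≤ n)
    (hpos : 0 < supInfQpetz (tpow ρ n) (S n)) :
    supInfQpetz (tpow ρ m) (S m) * supInfQpetz (tpow ρ n) (S n) ≤
      supInfQpetz (tpow ρ (m + n)) (S (m + n)) := by
  have hmn : 1 ≤ m + n := hm.trans (Nat.le_add_right m n)
  have key : ∀ σ ∈ S m, ∀ τ ∈ S n, infQpetz (tpow ρ m) σ * infQpetz (tpow ρ n) τ ≤
      supInfQpetz (tpow ρ (m + n)) (S (m + n)) := by
    intro σ hσ τ hτ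
    have hρm := tpow_posSemidef hρ m
    have hρn := tpow_posSemidef hρ n
    have hσ0 := hS.psd m hm σ hσ
    have hτ0 := hS.psd n hn τ hτ
    refine le_trans (le_infQpetz fun s hs => ?_) (le_supInfQpetz (tpow_posSemidef hρ _)
      (hS.compact _ hmn) (hS.psd _ hmn) (hS.tens m n hm hn σ hσ τ hτ))
    rw [tpow_add, Qpetz_tens hρm hσ0 hρn hτ0]
    exact mul_le_mul (infQpetz_le hρm hσ0 hs) (infQpetz_le hρn hτ0 hs)
      (infQpetz_nonneg hρn hτ0) (Qpetz_nonneg hρm hσ0 s)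
  rw [← le_div_iff₀ hpos]
  refine csSup_le ((hS.nonempty h1 hm).image _) ?_
  rintro _ ⟨σ, hσ, rfl⟩
  have hσ0 := infQpetz_nonneg (tpow_posSemidef hρ m) (hS.psd m hm σ hσ)
  rw [le_div_iff₀ hpos]
  rcases hσ0.eq_or_lt with h0 | h0
  · rw [← h0, zero_mul]
    obtain ⟨τ, hτ⟩ := hS.nonempty h1 hn
    have := key σ hσ τ hτ
    rwa [← h0, zero_mul] at this
  · rw [mul_comm, ← le_div_iff₀ h0]
    refine csSup_le ((hS.nonempty h1 hn).image _) ?_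
    rintro _ ⟨τ, hτ, rfl⟩
    rw [le_div_iff₀ h0, mul_comm]
    exact key σ hσ τ hτ

lemma smul_one_posSemidef {κ : Type*} [Fintype κ] [DecidableEq κ] {a : ℝ} (ha : 0 ≤ a) :
    ((a : ℂ) • (1 : Matrix κ κ ℂ)).PosSemidef :=
  PosSemidef.one.smul (by exact_mod_cast ha)

lemma rtr_smul_one_mul {κ : Type*} [Fintype κ] [DecidableEq κ] (a : ℝ) (σ : Matrix κ κ ℂ) :
    rtr (((a : ℂ) • (1 : Matrix κ κ ℂ)) * σ) = a * rtr σ := by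
  rw [smul_mul_assoc, one_mul, rtr, trace_smul, smul_eq_mul, Complex.re_ofReal_mul]
  rfl

lemma Assumption1.rtr_le_pow (hS : Assumption1 S) {C : ℝ} (hC : 1 ≤ C)
    (h : ∀ σ ∈ S 1, rtr σ ≤ C) {n : ℕ} (hn : 1 ≤ n) {σ : Matrix (Fin n → Fin d) (Fin n → Fin d) ℂ}
    (hσ : σ ∈ S n) : rtr σ ≤ C ^ n := by
  have hC0 : 0 < C := zero_lt_one.trans_le hC
  have hpol1 : (((C⁻¹ : ℝ) : ℂ) • 1 : Matrix (Fin 1 → Fin d) (Fin 1 → Fin d) ℂ) ∈ polar (S 1) :=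
    ⟨smul_one_posSemidef (by positivity), fun Y hY => by
      rw [rtr_smul_one_mul, inv_mul_le_iff₀ hC0, mul_one]
      exact h Y hY⟩
  have hpol : ((((C⁻¹) ^ n : ℝ) : ℂ) • 1 : Matrix (Fin n → Fin d) (Fin n → Fin d) ℂ) ∈
      polar (S n) := by
    clear hσ σ
    induction n, hn using Nat.le_induction with
    | base => rwa [pow_one]
    | succ n hn ih =>
      have := hS.polarTens _ _ hn le_rfl _ ih _ hpol1
      rwa [tensOp_smul_smul, tensOp_one, ← Complex.ofReal_mul, ← pow_succ] at this
  have h2 := hpol.2 σ hσ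
  rwa [rtr_smul_one_mul, inv_pow, inv_mul_le_iff₀ (by positivity), mul_one] at h2

lemma Assumption1.exists_supInfQpetz_le_pow (hS : Assumption1 S) (hρ : IsState ρ)
    (h1 : (S 1).Nonempty) :
    ∃ C > (0 : ℝ), ∀ n, 1 ≤ n → supInfQpetz (tpow ρ n) (S n) ≤ C ^ n := by
  obtain ⟨C, hC, h⟩ := exists_one_le_rtr_le (hS.compact 1 le_rfl)
  refine ⟨2 * C, by linarith, fun n hn => csSup_le ((hS.nonempty h1 hn).image _) ?_⟩
  rintro _ ⟨σ, hσ, rfl⟩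
  have hρn := tpow_isState hρ n
  have htr : rtr (tpow ρ n) = 1 := by rw [rtr, hρn.2, Complex.one_re]
  have hle := infQpetz_le_add hρn.1 (hS.psd n hn σ hσ)
  have hσC := hS.rtr_le_pow hC h hn hσ
  have hC1 : 1 ≤ C ^ n := one_le_pow₀ hC
  have h2 : (2 : ℝ) ≤ 2 ^ n := le_self_pow₀ one_le_two (by omega)
  rw [mul_pow]
  nlinarith

end Regularization

section Limit

open Matrix

variable {d : ℕ} {ρ : Matrix (Fin d) (Fin d) ℂ}
  {S : (n : ℕ) → Set (Matrix (Fin n → Fin d) (Fin n → Fin d) ℂ)}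

lemma Assumption1.exists_tendsto_log_supInfQpetz (hS : Assumption1 S) (hρ : IsState ρ)
    (h1 : (S 1).Nonempty) (hpos : ∀ n, 1 ≤ n → 0 < supInfQpetz (tpow ρ n) (S n)) :
    ∃ L : ℝ, Tendsto (fun n : ℕ => (n : ℝ)⁻¹ * -Real.log (supInfQpetz (tpow ρ n) (S n))) atTop
      (nhds L) := by
  set q : ℕ → ℝ := fun n => supInfQpetz (tpow ρ n) (S n) with hq
  set u : ℕ → ℝ := fun n => if n = 0 then 0 else -Real.log (q n) with hu
  have hun : ∀ n, 1 ≤ n → u n = -Real.log (q n) := fun n hn => if_neg (by omega)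
  have hsub : Subadditive u := by
    intro m n
    rcases Nat.eq_zero_or_pos m with rfl | hm
    · simp [hu]
    rcases Nat.eq_zero_or_pos n with rfl | hn
    · simp [hu]
    rw [hun m hm, hun n hn, hun (m + n) (by omega), ← neg_add,
      ← Real.log_mul (hpos m hm).ne' (hpos n hn).ne']
    exact neg_le_neg (Real.log_le_log (mul_pos (hpos m hm) (hpos n hn))
      (hS.mul_supInfQpetz_le hρ.1 h1 hm hn (hpos n hn)))
  obtain ⟨C, hC0, hC⟩ := hS.exists_supInfQpetz_le_pow hρ h1
  have hbdd : BddBelow (range fun n => u n / n) := by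
    refine ⟨min 0 (-Real.log C), ?_⟩
    rintro _ ⟨n, rfl⟩
    rcases Nat.eq_zero_or_pos n with rfl | hn
    · simp
    · have hn' : (0 : ℝ) < n := by exact_mod_cast hn
      have h := Real.log_le_log (hpos n hn) (hC n hn)
      rw [Real.log_pow] at h
      refine min_le_of_right_le ?_
      rw [le_div_iff₀ hn', hun n hn]
      linarith
  refine ⟨hsub.lim, (hsub.tendsto_lim hbdd).congr' ?_⟩
  filter_upwards [eventually_ge_atTop 1] with n hn
  rw [hun n hn, div_eq_inv_mul]

lemma chernoffExp_eq_liminf_minError :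
    chernoffExp ρ S = liminf (fun n => rate n (minError (tpow ρ n) (S n))) atTop := rfl

lemma Assumption1.le_chernoffExp (hS : Assumption1 S) (hρ : ρ.PosSemidef) (h1 : (S 1).Nonempty)
    (hpos : ∀ n, 1 ≤ n → 0 < supInfQpetz (tpow ρ n) (S n)) {L : ℝ}
    (hL : Tendsto (fun n : ℕ => (n : ℝ)⁻¹ * -Real.log (supInfQpetz (tpow ρ n) (S n))) atTop
      (nhds L)) : (L : EReal) ≤ chernoffExp ρ S := by
  rw [chernoffExp_eq_liminf_minError]
  refine EReal.ge_of_forall_gt_iff_ge.1 fun z hz => le_liminf_of_le (h := ?_)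
  filter_upwards [hL.eventually_const_lt (EReal.coe_lt_coe_iff.1 hz), eventually_ge_atTop 1]
    with n hn hn1
  have hn' : (0 : ℝ) < n := by exact_mod_cast hn1
  refine le_rate hn1 ((minError_le_supInfQpetz (tpow_posSemidef hρ n) (hS.nonempty h1 hn1)
    (hS.compact n hn1) (hS.convex n hn1) (hS.psd n hn1)).trans ?_)
  rw [← Real.log_le_iff_le_exp (hpos n hn1)]
  rw [lt_inv_mul_iff₀ hn'] at hn
  linarith

lemma Assumption1.chernoffExp_le (hS : Assumption1 S) (hρ : ρ.PosSemidef) (h1 : (S 1).Nonempty)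
    (hpos : ∀ n, 1 ≤ n → 0 < supInfQpetz (tpow ρ n) (S n)) {L : ℝ}
    (hL : Tendsto (fun n : ℕ => (n : ℝ)⁻¹ * -Real.log (supInfQpetz (tpow ρ n) (S n))) atTop
      (nhds L)) : chernoffExp ρ S ≤ L := by
  rw [chernoffExp_eq_liminf_minError]
  refine EReal.le_of_forall_lt_iff_le.1 fun z hz => ?_
  obtain ⟨w, hLw, hwz⟩ := exists_between (EReal.coe_lt_coe_iff.1 hz)
  obtain ⟨m, hm, hm1⟩ := ((hL.eventually_lt_const hLw).and (eventually_ge_atTop 1)).exists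
  have hm' : (0 : ℝ) < m := by exact_mod_cast hm1
  rw [inv_mul_lt_iff₀ hm', neg_lt, Real.lt_log_iff_exp_lt (hpos m hm1)] at hm
  obtain ⟨σ, hσ, hlt⟩ := exists_lt_infQpetz (hS.nonempty h1 hm1) hm
  have hρm := tpow_posSemidef hρ m
  have hσ0 := hS.psd m hm1 σ hσ
  obtain ⟨ε, hε, hεdef⟩ : ∃ ε > 0, 2 * ε = m * (z - w) :=
    ⟨m * (z - w) / 2, by have := sub_pos.2 hwz; positivity, by ring⟩
  obtain ⟨k₀, hk₀⟩ := exists_le_error_of_Qpetz_eq_pow hρm hσ0 (Real.exp_pos (-(m * w)))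
    (fun s hs => hlt.le.trans (infQpetz_le hρm hσ0 hs)) hε
  refine liminf_le_of_frequently_le' (frequently_atTop.2 fun N => ?_)
  obtain ⟨k, hk⟩ := exists_nat_ge (12 / ε)
  have hk12 : 12 ≤ Real.exp (ε * ((max (max k N) (max k₀ 1) : ℕ) : ℝ)) := by
    rw [div_le_iff₀ hε] at hk
    have : (k : ℝ) ≤ ((max (max k N) (max k₀ 1) : ℕ) : ℝ) := by
      exact_mod_cast (le_max_left k N).trans (le_max_left _ _)
    nlinarith [Real.add_one_le_exp (ε * ((max (max k N) (max k₀ 1) : ℕ) : ℝ))]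
  have hkN : N ≤ max (max k N) (max k₀ 1) := (le_max_right k N).trans (le_max_left _ _)
  have hk0 : k₀ ≤ max (max k N) (max k₀ 1) := (le_max_left k₀ 1).trans (le_max_right _ _)
  have hk1 : 1 ≤ max (max k N) (max k₀ 1) := (le_max_right k₀ 1).trans (le_max_right _ _)
  generalize max (max k N) (max k₀ 1) = K at *
  have hmK : 1 ≤ m * K := Nat.mul_pos hm1 hk1
  refine ⟨m * K, hkN.trans (Nat.le_mul_of_pos_left K hm1), rate_le hmK ?_⟩
  obtain ⟨σ', hσ', hQ⟩ := hS.exists_Qpetz_eq_pow hρ hm1 hσ hk1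
  refine le_trans ?_ (le_minError (hS.compact _ hmK) hσ' fun T hT =>
    hk₀ K hk0 _ _ σ' T (tpow_posSemidef hρ _) (hS.psd _ hmK _ hσ') hQ hT)
  rw [le_div_iff₀ (by norm_num), ← Real.exp_nat_mul, ← Real.exp_add]
  calc Real.exp (-((m * K : ℕ) * z)) * 12
      ≤ Real.exp (-((m * K : ℕ) * z)) * Real.exp (ε * K) :=
        mul_le_mul_of_nonneg_left hk12 (Real.exp_pos _).le
    _ = Real.exp (-(ε * K) + K * -(m * w)) := by
        rw [← Real.exp_add]
        congr 1
        push_cast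
        linear_combination (K : ℝ) * hεdef

lemma tendsto_inv_mul_ereal {f : ℕ → EReal} {g : ℕ → ℝ} {L : ℝ}
    (h : ∀ n, 1 ≤ n → f n = (g n : EReal))
    (hg : Tendsto (fun n : ℕ => (n : ℝ)⁻¹ * g n) atTop (nhds L)) :
    Tendsto (fun n : ℕ => (((n : ℝ)⁻¹ : ℝ) : EReal) * f n) atTop (nhds (L : EReal)) := by
  refine (EReal.tendsto_coe.2 hg).congr' ?_
  filter_upwards [eventually_ge_atTop 1] with n hn
  rw [h n hn, EReal.coe_mul]

end Limit

end QHT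

namespace QHT

/-- Theorem 26 of the paper: characterization of the Chernoff exponent
for generalized quantum hypothesis testing by regularized minimized Petz Rényi
divergences; both limits exist and equal the Chernoff exponent. -/
theorem chernoff_exponent_characterization {d : ℕ}
    (ρ : Matrix (Fin d) (Fin d) ℂ) (hρ : IsState ρ)
    (S : (n : ℕ) → Set (Matrix (Fin n → Fin d) (Fin n → Fin d) ℂ))
    (hS : Assumption1 S)
    (hsupp : ∃ τ ∈ S 1, IsState τ ∧ msupp (tpow ρ 1) ≤ msupp τ) :
    Filter.Tendsto
      (fun n : ℕ => (((n : ℝ)⁻¹ : ℝ) : EReal) *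
        ⨆ α ∈ Set.Ioo (0 : ℝ) 1, ⨅ σ ∈ S n, ((1 - α : ℝ) : EReal) * Dpetz α (tpow ρ n) σ)
      Filter.atTop (nhds (chernoffExp ρ S)) ∧
    Filter.Tendsto
      (fun n : ℕ => (((n : ℝ)⁻¹ : ℝ) : EReal) *
        ⨅ σ ∈ S n, ⨆ α ∈ Set.Ioo (0 : ℝ) 1, ((1 - α : ℝ) : EReal) * Dpetz α (tpow ρ n) σ)
      Filter.atTop (nhds (chernoffExp ρ S)) := by
  obtain ⟨τ, hτ, hτs, hle⟩ := hsupp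
  have hρ1 := tpow_isState hρ 1
  obtain ⟨c, hc, hcQ⟩ := exists_pos_le_Qpetz hρ1.1 hτs.1
    (trace_mul_ne_zero_of_msupp_le hρ1.1 hρ1.ne_zero hτs.1 hle)
  have h1 : (S 1).Nonempty := ⟨τ, hτ⟩
  have hpos : ∀ n, 1 ≤ n → 0 < supInfQpetz (tpow ρ n) (S n) := fun n hn =>
    (pow_pos hc n).trans_le (hS.pow_le_supInfQpetz hρ.1 hc hτ
      (fun s hs => hcQ s (Ioo_subset_Icc_self hs)) hn)
  obtain ⟨L, hL⟩ := hS.exists_tendsto_log_supInfQpetz hρ h1 hpos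
  rw [(hS.chernoffExp_le hρ.1 h1 hpos hL).antisymm (hS.le_chernoffExp hρ.1 h1 hpos hL)]
  have heq := fun n (hn : 1 ≤ n) => iSup_iInf_Dpetz_and_iInf_iSup_Dpetz (tpow_isState hρ n)
    (hS.nonempty h1 hn) (hS.compact n hn) (hS.convex n hn) (hS.psd n hn) (hpos n hn)
  exact ⟨tendsto_inv_mul_ereal (fun n hn => (heq n hn).1) hL,
    tendsto_inv_mul_ereal (fun n hn => (heq n hn).2) hL⟩

end QHT
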